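/- There is a constant C > 0 (depending only on the dyadic partition) such that for every smooth divergence-free vector field u = (u¹,u²) : 𝕋² → ℝ², every smooth function f : 𝕋² → ℝ, and all integers k ≥ −1 and k' ≥ −1 with |k−k'| ≤ N₀, the commutator satisfies ‖[Δ^v_k, S^v_{k'−1}u²] f‖_{L²_v(L^{4/3}_h)} ≤ C 2^{-k} ‖S^v_{k'−1}∂₁u¹‖_{L^∞_v(L²_h)} ‖f‖_{L²_v(H^{1/4}_h)}, where [Δ^v_k, a] f = Δ^v_k(a f) − a Δ^v_k f. -/

import Mathlib

open MeasureTheory Real Complex Filter Set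

noncomputable section

namespace Aniso

/-- Fundamental domain `(0, 2π]` for the circle of circumference `2π`. -/
def I2pi : Set ℝ := Set.Ioc 0 (2 * π)

/-- Fundamental domain for the 2-torus `𝕋² = (ℝ/2πℤ)²`. -/
def Q2 : Set (ℝ × ℝ) := I2pi ×ˢ I2pi

/-- Integral over the torus of a real function. -/
def tintR (f : ℝ × ℝ → ℝ) : ℝ := ∫ x in Q2, f x

/-- Smoothness of a scalar field. -/
def Smooth (f : ℝ × ℝ → ℝ) : Prop := ContDiff ℝ (⊤ : ℕ∞) f

/-- Smoothness of a vector field. -/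
def SmoothV (u : ℝ × ℝ → ℝ × ℝ) : Prop := ContDiff ℝ (⊤ : ℕ∞) u

/-- `2π`-periodicity in each variable: this encodes being a function on the torus. -/
def Per (f : ℝ × ℝ → ℝ) : Prop :=
  (∀ x : ℝ × ℝ, f (x.1 + 2 * π, x.2) = f x) ∧ (∀ x : ℝ × ℝ, f (x.1, x.2 + 2 * π) = f x)

def PerV (u : ℝ × ℝ → ℝ × ℝ) : Prop :=
  Per (fun x => (u x).1) ∧ Per (fun x => (u x).2)

/-- Partial derivative in the horizontal variable `x₁`. -/
def pd1 (f : ℝ × ℝ → ℝ) : ℝ × ℝ → ℝ := fun x => fderiv ℝ f x (1, 0)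

/-- Partial derivative in the vertical variable `x₂`. -/
def pd2 (f : ℝ × ℝ → ℝ) : ℝ × ℝ → ℝ := fun x => fderiv ℝ f x (0, 1)

def comp1 (u : ℝ × ℝ → ℝ × ℝ) : ℝ × ℝ → ℝ := fun x => (u x).1
def comp2 (u : ℝ × ℝ → ℝ × ℝ) : ℝ × ℝ → ℝ := fun x => (u x).2

def pd1V (u : ℝ × ℝ → ℝ × ℝ) : ℝ × ℝ → ℝ × ℝ := fun x => (pd1 (comp1 u) x, pd1 (comp2 u) x)
def pd2V (u : ℝ × ℝ → ℝ × ℝ) : ℝ × ℝ → ℝ × ℝ := fun x => (pd2 (comp1 u) x, pd2 (comp2 u) x)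

/-- Divergence-free condition `∂₁u¹ + ∂₂u² = 0`. -/
def DivFree (u : ℝ × ℝ → ℝ × ℝ) : Prop :=
  ∀ x, pd1 (comp1 u) x + pd2 (comp2 u) x = 0

/-- The transport term `u·∇v`, with components `u¹∂₁vʲ + u²∂₂vʲ`. -/
def advect (u v : ℝ × ℝ → ℝ × ℝ) : ℝ × ℝ → ℝ × ℝ := fun x =>
  ((u x).1 * pd1 (comp1 v) x + (u x).2 * pd2 (comp1 v) x,
   (u x).1 * pd1 (comp2 v) x + (u x).2 * pd2 (comp2 v) x)

/-- L² inner product of real vector fields on the torus (summed over components). -/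
def ipV (u v : ℝ × ℝ → ℝ × ℝ) : ℝ := tintR fun x => (u x).1 * (v x).1 + (u x).2 * (v x).2

/-- The trilinear form `b(u,v,w) = ∫ (u·∇v)·w`. -/
def b3 (u v w : ℝ × ℝ → ℝ × ℝ) : ℝ := ipV (advect u v) w

/-- L² norm of a scalar function on the torus. -/
def L2 (f : ℝ × ℝ → ℝ) : ℝ := Real.sqrt (tintR fun x => f x ^ 2)

/-- L² norm of a vector field on the torus. -/
def L2V (u : ℝ × ℝ → ℝ × ℝ) : ℝ := Real.sqrt (tintR fun x => (u x).1 ^ 2 + (u x).2 ^ 2)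

/-- Fourier coefficient of a complex-valued function on the torus. -/
def fcC (f : ℝ × ℝ → ℂ) (k : ℤ × ℤ) : ℂ :=
  (1 / (2 * π) ^ 2 : ℂ) *
    ∫ x in Q2, f x * Complex.exp (-(Complex.I) * ((k.1 : ℂ) * (x.1 : ℂ) + (k.2 : ℂ) * (x.2 : ℂ)))

/-- Fourier coefficient of a real-valued function on the torus. -/
def fc (f : ℝ × ℝ → ℝ) (k : ℤ × ℤ) : ℂ := fcC (fun x => (f x : ℂ)) k

/-- Anisotropic Sobolev weight `(1+|k₁|²)^s (1+|k₂|²)^{s'}`. -/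
def aw (s s' : ℝ) (k : ℤ × ℤ) : ℝ :=
  (1 + (k.1 : ℝ) ^ 2) ^ s * (1 + (k.2 : ℝ) ^ 2) ^ s'

/-- Square of the anisotropic Sobolev norm `H^{s,s'}` of a scalar function. -/
def HSq (s s' : ℝ) (f : ℝ × ℝ → ℝ) : ℝ := ∑' k : ℤ × ℤ, aw s s' k * ‖fc f k‖ ^ 2

/-- Anisotropic Sobolev norm `H^{s,s'}` of a scalar function. -/
def HN (s s' : ℝ) (f : ℝ × ℝ → ℝ) : ℝ := Real.sqrt (HSq s s' f)

/-- Anisotropic Sobolev norm `H^{s,s'}` of a vector field. -/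
def HNV (s s' : ℝ) (u : ℝ × ℝ → ℝ × ℝ) : ℝ :=
  Real.sqrt (HSq s s' (comp1 u) + HSq s s' (comp2 u))

/-- Mixed norm `L^∞_h(L²_v)`. -/
def LinfhL2v (f : ℝ × ℝ → ℝ) : ℝ :=
  essSup (fun x1 : ℝ => Real.sqrt (∫ x2 in I2pi, f (x1, x2) ^ 2)) (volume.restrict I2pi)

/-- Mixed norm `L²_h(L^∞_v)`. -/
def L2hLinfv (f : ℝ × ℝ → ℝ) : ℝ :=
  Real.sqrt (∫ x1 in I2pi, (essSup (fun x2 : ℝ => |f (x1, x2)|) (volume.restrict I2pi)) ^ 2)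

/-- Mixed norm `L²_v(L^{4/3}_h)`. -/
def L2vL43h {E : Type*} [NormedAddCommGroup E] (f : ℝ × ℝ → E) : ℝ :=
  Real.sqrt (∫ x2 in I2pi, (∫ x1 in I2pi, ‖f (x1, x2)‖ ^ ((4 : ℝ)/3)) ^ ((3 : ℝ)/2))

/-- Mixed norm `L^∞_v(L²_h)`. -/
def LinfvL2h {E : Type*} [NormedAddCommGroup E] (f : ℝ × ℝ → E) : ℝ :=
  essSup (fun x2 : ℝ => Real.sqrt (∫ x1 in I2pi, ‖f (x1, x2)‖ ^ 2)) (volume.restrict I2pi)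

/-- Mixed norm `L²_v(L⁴_h)`. -/
def L2vL4h {E : Type*} [NormedAddCommGroup E] (f : ℝ × ℝ → E) : ℝ :=
  Real.sqrt (∫ x2 in I2pi, Real.sqrt (∫ x1 in I2pi, ‖f (x1, x2)‖ ^ 4))

/-- One-dimensional Fourier coefficient on the circle of circumference `2π`. -/
def fc1 (g : ℝ → ℂ) (n : ℤ) : ℂ :=
  (1 / (2 * π) : ℂ) * ∫ x in I2pi, g x * Complex.exp (-(Complex.I) * ((n : ℂ) * (x : ℂ)))

/-- Square of the 1-d Sobolev norm `H^s(𝕋)`. -/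
def H1Sq (s : ℝ) (g : ℝ → ℂ) : ℝ := ∑' n : ℤ, (1 + (n : ℝ) ^ 2) ^ s * ‖fc1 g n‖ ^ 2

/-- Mixed norm `L²_v(H^s_h)`. -/
def L2vHsh (s : ℝ) (f : ℝ × ℝ → ℂ) : ℝ :=
  Real.sqrt (∫ x2 in I2pi, H1Sq s (fun x1 => f (x1, x2)))

/-- A dyadic partition of unity `(χ, θ)` on `ℝ`. -/
structure IsDyadicPartition (χ θ : ℝ → ℝ) : Prop where
  smooth_chi : ContDiff ℝ (⊤ : ℕ∞) χ
  smooth_theta : ContDiff ℝ (⊤ : ℕ∞) θ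
  nonneg_chi : ∀ z, 0 ≤ χ z
  nonneg_theta : ∀ z, 0 ≤ θ z
  even_chi : ∀ z, χ (-z) = χ z
  even_theta : ∀ z, θ (-z) = θ z
  chi_support : ∃ R > 0, ∀ z, R ≤ |z| → χ z = 0
  theta_support : ∃ r R : ℝ, 0 < r ∧ r < R ∧ ∀ z, (|z| < r ∨ R < |z|) → θ z = 0
  partition : ∀ z : ℝ, χ z + ∑' j : ℕ, θ ((2 : ℝ) ^ (-(j : ℤ)) * z) = 1
  chi_theta_disj : ∀ j : ℕ, 1 ≤ j → ∀ z, χ z * θ ((2 : ℝ) ^ (-(j : ℤ)) * z) = 0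
  theta_theta_disj : ∀ i j : ℕ, 1 < |(i : ℤ) - (j : ℤ)| → ∀ z,
    θ ((2 : ℝ) ^ (-(i : ℤ)) * z) * θ ((2 : ℝ) ^ (-(j : ℤ)) * z) = 0

/-- The Fourier multiplier symbol of the vertical Littlewood–Paley block `Δ^v_j`. -/
def blockSymb (χ θ : ℝ → ℝ) (j : ℤ) (z : ℝ) : ℝ :=
  if j = -1 then χ |z| else if 0 ≤ j then θ ((2 : ℝ) ^ (-j) * |z|) else 0

/-- The Fourier multiplier symbol of the vertical low-frequency cut-off `S^v_j`. -/
def lowSymb (χ θ : ℝ → ℝ) (j : ℤ) (z : ℝ) : ℝ :=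
  ∑ j' ∈ Finset.Icc (-1 : ℤ) (j - 2), blockSymb χ θ j' z

/-- The character `e^{ik·x}`. -/
def eK (k : ℤ × ℤ) (x : ℝ × ℝ) : ℂ :=
  Complex.exp (Complex.I * ((k.1 : ℂ) * (x.1 : ℂ) + (k.2 : ℂ) * (x.2 : ℂ)))

/-- Vertical Littlewood–Paley block `Δ^v_j` of a complex-valued function. -/
def LPC (χ θ : ℝ → ℝ) (j : ℤ) (f : ℝ × ℝ → ℂ) : ℝ × ℝ → ℂ :=
  fun x => ∑' k : ℤ × ℤ, (blockSymb χ θ j k.2 : ℂ) * fcC f k * eK k x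

/-- Vertical Littlewood–Paley block `Δ^v_j` of a real-valued function. -/
def LP (χ θ : ℝ → ℝ) (j : ℤ) (f : ℝ × ℝ → ℝ) : ℝ × ℝ → ℂ :=
  LPC χ θ j fun x => (f x : ℂ)

/-- Vertical low-frequency cut-off `S^v_j` of a complex-valued function. -/
def SvC (χ θ : ℝ → ℝ) (j : ℤ) (f : ℝ × ℝ → ℂ) : ℝ × ℝ → ℂ :=
  fun x => ∑' k : ℤ × ℤ, (lowSymb χ θ j k.2 : ℂ) * fcC f k * eK k x

/-- Vertical low-frequency cut-off `S^v_j` of a real-valued function. -/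
def Sv (χ θ : ℝ → ℝ) (j : ℤ) (f : ℝ × ℝ → ℝ) : ℝ × ℝ → ℂ :=
  SvC χ θ j fun x => (f x : ℂ)

/-- Componentwise Littlewood–Paley block of a vector field. -/
def LPV (χ θ : ℝ → ℝ) (j : ℤ) (u : ℝ × ℝ → ℝ × ℝ) : ℝ × ℝ → ℂ × ℂ :=
  fun x => (LP χ θ j (comp1 u) x, LP χ θ j (comp2 u) x)

/-- Componentwise low-frequency cut-off of a vector field. -/
def SvV (χ θ : ℝ → ℝ) (j : ℤ) (u : ℝ × ℝ → ℝ × ℝ) : ℝ × ℝ → ℂ × ℂ :=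
  fun x => (Sv χ θ j (comp1 u) x, Sv χ θ j (comp2 u) x)

/-- L² inner product of complex-valued functions on the torus. -/
def ipC (f g : ℝ × ℝ → ℂ) : ℂ := ∫ x in Q2, f x * (starRingEnd ℂ) (g x)

/-- L² inner product of complex vector fields on the torus (summed over components). -/
def ipCV (f g : ℝ × ℝ → ℂ × ℂ) : ℂ :=
  ∫ x in Q2, ((f x).1 * (starRingEnd ℂ) ((g x).1) + (f x).2 * (starRingEnd ℂ) ((g x).2))

/-- The vertical paraproduct `T^v_a g = Σ_j S^v_{j-1}a · Δ^v_j g`. -/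
def Tv (χ θ : ℝ → ℝ) (a g : ℝ × ℝ → ℝ) : ℝ × ℝ → ℂ :=
  fun x => ∑' j : ℤ, Sv χ θ (j - 1) a x * LP χ θ j g x

/-- The vertical remainder `R^v(a,g) = Σ_{|j-j'|≤1} Δ^v_j a · Δ^v_{j'} g`. -/
def Rv (χ θ : ℝ → ℝ) (a g : ℝ × ℝ → ℝ) : ℝ × ℝ → ℂ :=
  fun x => ∑' p : ℤ × ℤ, if |p.1 - p.2| ≤ 1 then LP χ θ p.1 a x * LP χ θ p.2 g x else 0

lemma integral_I2pi {E : Type*} [NormedAddCommGroup E] [NormedSpace ℝ E] (g : ℝ → E) :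
    ∫ x in I2pi, g x = ∫ x in (0 : ℝ)..(2 * π), g x := by
  rw [intervalIntegral.integral_of_le (by positivity)]; rfl

lemma integrableOn_I2pi_of_continuous {E : Type*} [NormedAddCommGroup E] {g : ℝ → E}
    (hg : Continuous g) : IntegrableOn g I2pi :=
  (hg.integrableOn_Icc (a := 0) (b := 2 * π)).mono_set Ioc_subset_Icc_self

lemma fc1_eq_fourierCoeffOn (g : ℝ → ℂ) (n : ℤ) :
    fc1 g n = fourierCoeffOn Real.two_pi_pos g n := by
  rw [fourierCoeffOn_eq_integral, fc1, integral_I2pi]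
  simp only [smul_eq_mul, fourier_coe_apply, real_smul]
  congr 1
  · simp
  · refine intervalIntegral.integral_congr fun x _ => ?_
    simp only [mul_comm (g x)]
    congr 2
    have : (π : ℂ) ≠ 0 := by exact_mod_cast Real.pi_ne_zero
    push_cast
    field_simp
    ring

lemma fc1_hasSum_sq {g : ℝ → ℂ} (hg : Continuous g) :
    HasSum (fun n => ‖fc1 g n‖ ^ 2) ((2 * π)⁻¹ * ∫ x in I2pi, ‖g x‖ ^ 2) := by
  have hL : MemLp g 2 (volume.restrict (Ioc 0 (2 * π))) := by
    refine (memLp_two_iff_integrable_sq_norm hg.aestronglyMeasurable).2 ?_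
    exact integrableOn_I2pi_of_continuous (by fun_prop)
  have := hasSum_sq_fourierCoeffOn Real.two_pi_pos hL
  simp only [fc1_eq_fourierCoeffOn, integral_I2pi]
  simpa using this

lemma fc1_sub {g h : ℝ → ℂ} (hg : Continuous g) (hh : Continuous h) (n : ℤ) :
    fc1 (fun x => g x - h x) n = fc1 g n - fc1 h n := by
  simp only [fc1, sub_mul]
  rw [integral_sub, mul_sub] <;> exact integrableOn_I2pi_of_continuous (by fun_prop)

lemma fc1_sum {ι : Type*} (s : Finset ι) {g : ι → ℝ → ℂ} (hg : ∀ i, Continuous (g i)) (n : ℤ) :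
    fc1 (fun x => ∑ i ∈ s, g i x) n = ∑ i ∈ s, fc1 (g i) n := by
  simp only [fc1, Finset.sum_mul]
  rw [integral_finsetSum, Finset.mul_sum]
  intro i _
  have := hg i
  exact integrableOn_I2pi_of_continuous (by fun_prop)

lemma fc1_const_mul (c : ℂ) (g : ℝ → ℂ) (n : ℤ) :
    fc1 (fun x => c * g x) n = c * fc1 g n := by
  simp only [fc1, mul_assoc]
  rw [integral_const_mul]; ring

lemma fc1_exp (m n : ℤ) :
    fc1 (fun x => Complex.exp (Complex.I * ((m : ℂ) * (x : ℂ)))) n = if m = n then 1 else 0 := by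
  have : Fact (0 < 2 * π) := ⟨Real.two_pi_pos⟩
  have hpi : (π : ℂ) ≠ 0 := by exact_mod_cast Real.pi_ne_zero
  have h := congrFun (fourierCoeff_fourier (T := 2 * π) m) n
  rw [fourierCoeff_eq_intervalIntegral _ _ 0] at h
  rw [Pi.single_apply] at h
  rw [fc1, integral_I2pi]
  simp only [eq_comm (a := m)]
  rw [← h, zero_add, real_smul]
  congr 1
  · simp
  · refine intervalIntegral.integral_congr fun x _ => ?_
    simp only [fourier_coe_apply, smul_eq_mul, mul_comm (Complex.exp (Complex.I * _))]
    congr 2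
    · push_cast
      field_simp
    · push_cast
      field_simp

lemma fc1_inversion {g : ℝ → ℂ} (hg : Continuous g) (hp : Function.Periodic g (2 * π))
    (hs : Summable (fc1 g)) (x : ℝ) :
    HasSum (fun n : ℤ => fc1 g n * Complex.exp (Complex.I * ((n : ℂ) * (x : ℂ)))) (g x) := by
  have : Fact (0 < 2 * π) := ⟨Real.two_pi_pos⟩
  have hpi : (π : ℂ) ≠ 0 := by exact_mod_cast Real.pi_ne_zero
  let G : C(AddCircle (2 * π), ℂ) := ⟨hp.lift, continuous_coinduced_dom.mpr hg⟩
  have hG : ∀ y : ℝ, G (y : AddCircle (2 * π)) = g y := fun y => hp.lift_coe y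
  have hc : fourierCoeff G = fc1 g := by
    funext n
    rw [fourierCoeff_eq_intervalIntegral _ _ 0, fc1, integral_I2pi, zero_add, real_smul]
    congr 1
    · simp
    · refine intervalIntegral.integral_congr fun x _ => ?_
      simp only [hG, fourier_coe_apply, smul_eq_mul, mul_comm (g x)]
      congr 2
      push_cast
      field_simp
  have := has_pointwise_sum_fourier_series_of_summable (f := G) (by rw [hc]; exact hs) (x : AddCircle (2 * π))
  rw [hG, hc] at this
  convert this using 2 with n
  simp only [fourier_coe_apply, smul_eq_mul]
  congr 2
  push_cast
  field_simp

lemma fc1_deriv {g g' : ℝ → ℂ} (hg : ∀ x, HasDerivAt g (g' x) x) (hg' : Continuous g')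
    (hp : Function.Periodic g (2 * π)) (n : ℤ) :
    fc1 g' n = Complex.I * n * fc1 g n := by
  have hpi : (π : ℂ) ≠ 0 := by exact_mod_cast Real.pi_ne_zero
  have h0 : g (2 * π) = g 0 := by simpa using hp 0
  have hi := hg'.intervalIntegrable (μ := volume) 0 (2 * π)
  rcases eq_or_ne n 0 with rfl | hn
  · rw [fc1, integral_I2pi]
    simp [intervalIntegral.integral_eq_sub_of_hasDerivAt (fun x _ => hg x) hi, h0]
  · have := fourierCoeffOn_of_hasDerivAt Real.two_pi_pos hn (fun x _ => hg x) hi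
    rw [← fc1_eq_fourierCoeffOn, ← fc1_eq_fourierCoeffOn, h0] at this
    rw [this]
    have hn' : (n : ℂ) ≠ 0 := by exact_mod_cast hn
    have hI : Complex.I ≠ 0 := Complex.I_ne_zero
    push_cast
    field_simp
    ring

lemma norm_exp_I_int_mul (n : ℤ) (x : ℝ) :
    ‖Complex.exp (Complex.I * ((n : ℂ) * (x : ℂ)))‖ = 1 := by
  rw [mul_comm]
  exact_mod_cast Complex.norm_exp_ofReal_mul_I (n * x)

lemma norm_exp_neg_I_int_mul (n : ℤ) (x : ℝ) :
    ‖Complex.exp (-Complex.I * ((n : ℂ) * (x : ℂ)))‖ = 1 := by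
  have := norm_exp_I_int_mul (-n) x
  rw [← this]; congr 2; push_cast; ring

lemma norm_fc1_le {g : ℝ → ℂ} {M : ℝ} (hM : ∀ x ∈ I2pi, ‖g x‖ ≤ M) (n : ℤ) : ‖fc1 g n‖ ≤ M := by
  have h : ‖∫ x in I2pi, g x * Complex.exp (-(Complex.I) * ((n : ℂ) * (x : ℂ)))‖ ≤ M * (2 * π) := by
    have := norm_setIntegral_le_of_norm_le_const (μ := volume) (s := I2pi)
      (f := fun x => g x * Complex.exp (-(Complex.I) * ((n : ℂ) * (x : ℂ)))) (C := M)
      (by simpa [I2pi] using ENNReal.mul_lt_top (by simp) ENNReal.ofReal_lt_top)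
      (fun x hx => by rw [norm_mul, norm_exp_neg_I_int_mul, mul_one]; exact hM x hx)
    simpa [I2pi, Measure.real, Real.pi_pos.le] using this
  rw [fc1, norm_mul]
  have e : ‖(1 / (2 * π) : ℂ)‖ = (2 * π)⁻¹ := by
    simp [abs_of_pos Real.pi_pos]
  rw [e]
  have hp := Real.two_pi_pos
  calc _ ≤ (2 * π)⁻¹ * (M * (2 * π)) := by gcongr
    _ = M := by field_simp

/-- Symmetric partial Fourier sum of order `N`. -/
def partialFourier (g : ℝ → ℂ) (N : ℕ) (x : ℝ) : ℂ :=
  ∑ n ∈ Finset.Icc (-(N : ℤ)) N, fc1 g n * Complex.exp (Complex.I * ((n : ℂ) * (x : ℂ)))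

lemma continuous_partialFourier (g : ℝ → ℂ) (N : ℕ) : Continuous (partialFourier g N) := by
  unfold partialFourier; fun_prop

lemma fc1_partialFourier (g : ℝ → ℂ) (N : ℕ) (n : ℤ) :
    fc1 (partialFourier g N) n = if n ∈ Finset.Icc (-(N : ℤ)) N then fc1 g n else 0 := by
  unfold partialFourier
  rw [fc1_sum _ (fun i => by fun_prop)]
  simp only [fc1_const_mul, fc1_exp, mul_ite, mul_one, mul_zero, Finset.sum_ite_eq']

lemma sum_weight_inv_le (N : ℕ) :
    ∑ n ∈ Finset.Icc (-(N : ℤ)) N, ((1 + (n : ℝ) ^ 2) ^ (1 / 4 : ℝ))⁻¹ ≤ 1 + 4 * √N := by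
  induction N with
  | zero => simp
  | succ N ih =>
    have hI : Finset.Icc (-((N + 1 : ℕ) : ℤ)) ((N + 1 : ℕ) : ℤ) =
        insert ((N : ℤ) + 1) (insert (-((N : ℤ) + 1)) (Finset.Icc (-(N : ℤ)) N)) := by
      ext x; simp only [Finset.mem_Icc, Finset.mem_insert]; push_cast; omega
    rw [hI, Finset.sum_insert (by simp only [Finset.mem_Icc, Finset.mem_insert]; omega),
      Finset.sum_insert (by simp only [Finset.mem_Icc]; omega)]
    have hw : √((N : ℝ) + 1) ≤ (1 + ((N : ℝ) + 1) ^ 2) ^ (1 / 4 : ℝ) := by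
      have h1 : √((N : ℝ) + 1) = (((N : ℝ) + 1) ^ 2) ^ (1 / 4 : ℝ) := by
        rw [Real.sqrt_eq_rpow, ← Real.rpow_natCast, ← Real.rpow_mul (by positivity)]; norm_num
      rw [h1]
      gcongr
      linarith
    have hpos : 0 < √((N : ℝ) + 1) := by positivity
    have h2 : ((1 + ((N : ℝ) + 1) ^ 2) ^ (1 / 4 : ℝ))⁻¹ ≤ (√((N : ℝ) + 1))⁻¹ := by gcongr
    have h3 : 2 * (√((N : ℝ) + 1))⁻¹ ≤ 4 * (√((N : ℝ) + 1) - √N) := by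
      have e1 := Real.sq_sqrt (show (0 : ℝ) ≤ N by positivity)
      have e2 := Real.sq_sqrt (show (0 : ℝ) ≤ N + 1 by positivity)
      have e3 := Real.sqrt_nonneg (N : ℝ)
      rw [← div_eq_mul_inv, div_le_iff₀ hpos]
      nlinarith [sq_nonneg (√((N : ℝ) + 1) - √N)]
    push_cast
    rw [neg_sq]
    linarith

lemma norm_partialFourier_le {g : ℝ → ℂ}
    (hs : Summable fun n : ℤ => (1 + (n : ℝ) ^ 2) ^ (1 / 4 : ℝ) * ‖fc1 g n‖ ^ 2) (j : ℕ) (x : ℝ) :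
    ‖partialFourier g (16 ^ j) x‖ ≤ √(5 * H1Sq (1 / 4) g) * 2 ^ j := by
  have hpos : ∀ n : ℤ, 0 < (1 + (n : ℝ) ^ 2) ^ (1 / 4 : ℝ) := fun n => by positivity
  set S := Finset.Icc (-((16 ^ j : ℕ) : ℤ)) ((16 ^ j : ℕ) : ℤ)
  have h1 : ‖partialFourier g (16 ^ j) x‖ ≤ ∑ n ∈ S, ‖fc1 g n‖ := by
    refine (norm_sum_le _ _).trans (Finset.sum_le_sum fun n _ => ?_)
    rw [norm_mul, norm_exp_I_int_mul, mul_one]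
  have h2 : (∑ n ∈ S, ‖fc1 g n‖) ^ 2 ≤
      (∑ n ∈ S, ((1 + (n : ℝ) ^ 2) ^ (1 / 4 : ℝ))⁻¹) *
        ∑ n ∈ S, (1 + (n : ℝ) ^ 2) ^ (1 / 4 : ℝ) * ‖fc1 g n‖ ^ 2 := by
    refine Finset.sum_sq_le_sum_mul_sum_of_sq_le_mul _ (fun n _ => (inv_pos.2 (hpos n)).le)
      (fun n _ => by have := hpos n; positivity) fun n _ => ?_
    exact (inv_mul_cancel_left₀ (hpos n).ne' _).ge
  have h3 : ∑ n ∈ S, (1 + (n : ℝ) ^ 2) ^ (1 / 4 : ℝ) * ‖fc1 g n‖ ^ 2 ≤ H1Sq (1 / 4) g :=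
    hs.sum_le_tsum S fun n _ => by have := hpos n; positivity
  have h4 : ∑ n ∈ S, ((1 + (n : ℝ) ^ 2) ^ (1 / 4 : ℝ))⁻¹ ≤ 5 * 4 ^ j := by
    refine (sum_weight_inv_le (16 ^ j)).trans ?_
    have : √((16 ^ j : ℕ) : ℝ) = 4 ^ j := by
      rw [Real.sqrt_eq_iff_mul_self_eq (by positivity) (by positivity)]
      push_cast; rw [← mul_pow]; norm_num
    rw [this]
    have : (1 : ℝ) ≤ 4 ^ j := one_le_pow₀ (by norm_num)
    linarith
  have hH : 0 ≤ H1Sq (1 / 4) g := tsum_nonneg fun n => by have := hpos n; positivity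
  refine h1.trans (abs_le_of_sq_le_sq' ?_ (by positivity)).2
  rw [mul_pow, Real.sq_sqrt (by positivity), ← pow_mul, mul_comm j, pow_mul]
  calc _ ≤ _ := h2
    _ ≤ (5 * 4 ^ j) * H1Sq (1 / 4) g := by
        gcongr
    _ = _ := by norm_num; ring

lemma sum_range_ite_four_pow_le {w : ℝ} (hw : 0 ≤ w) (J : ℕ) :
    ∑ j ∈ Finset.range J, (if (4 : ℝ) ^ j < w then (4 : ℝ) ^ j else 0) ≤ 2 * w := by
  have h1 : ∀ J : ℕ, ∑ j ∈ Finset.range J, (if (4 : ℝ) ^ j < w then (4 : ℝ) ^ j else 0) ≤ 4 ^ J := by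
    intro J
    induction J with
    | zero => simp
    | succ J ih =>
      rw [Finset.sum_range_succ, pow_succ]
      have : (0 : ℝ) < 4 ^ J := by positivity
      split_ifs <;> linarith
  induction J with
  | zero => simpa using hw
  | succ J ih =>
    rw [Finset.sum_range_succ]
    split_ifs with h
    · linarith [h1 J]
    · simpa using ih

lemma pow_four_le_of_dyadic {t M : ℝ} (ht : 0 ≤ t) (hM : 0 < M) {r : ℕ → ℝ}
    (h : ∀ j, t ≤ r j + M * 2 ^ j) :
    t ^ 4 ≤ 4 * M ^ 2 * t ^ 2 ∨ ∃ j, t ^ 4 ≤ 64 * M ^ 2 * (4 ^ j * r j ^ 2) := by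
  by_cases h0 : t ≤ 2 * M
  · left
    have : t ^ 2 ≤ (2 * M) ^ 2 := by gcongr
    nlinarith [sq_nonneg t]
  right
  push Not at h0
  have hex : ∃ j : ℕ, t ≤ 2 * M * 2 ^ j := by
    obtain ⟨j, hj⟩ := pow_unbounded_of_one_lt (t / (2 * M)) (one_lt_two)
    refine ⟨j, ?_⟩
    rw [div_lt_iff₀ (by positivity)] at hj
    linarith
  classical
  obtain ⟨j, hj⟩ : ∃ j, Nat.find hex = j + 1 := Nat.exists_eq_succ_of_ne_zero fun h => by
    have := Nat.find_spec hex
    rw [h] at this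
    simp at this; linarith
  have h1 := Nat.find_spec hex
  have h2 := Nat.find_min hex (m := j) (by omega)
  rw [hj] at h1
  push Not at h2
  refine ⟨j, ?_⟩
  have h3 : t ≤ 2 * r j := by linarith [h j]
  have h4 : t ^ 2 ≤ (2 * r j) ^ 2 := by gcongr
  have h5 : t ^ 2 ≤ (2 * M * 2 ^ (j + 1)) ^ 2 := by gcongr
  have h6 : (2 * M * 2 ^ (j + 1)) ^ 2 = 16 * M ^ 2 * 4 ^ j := by
    have : (4 : ℝ) ^ j = (2 ^ j) ^ 2 := by rw [← pow_mul, mul_comm, pow_mul]; norm_num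
    rw [this]; ring
  rw [h6] at h5
  calc t ^ 4 = t ^ 2 * t ^ 2 := by ring
    _ ≤ (16 * M ^ 2 * 4 ^ j) * (2 * r j) ^ 2 := by gcongr
    _ = _ := by ring

lemma lintegral_enorm_sq_eq {g : ℝ → ℂ} (hg : Continuous g) :
    ∫⁻ x in I2pi, ‖g x‖ₑ ^ 2 = ENNReal.ofReal (2 * π) * ∑' n, ‖fc1 g n‖ₑ ^ 2 := by
  have h := fc1_hasSum_sq hg
  have e : ∀ z : ℂ, ‖z‖ₑ ^ 2 = ENNReal.ofReal (‖z‖ ^ 2) := fun z => by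
    rw [ENNReal.ofReal_pow (norm_nonneg _), ofReal_norm]
  simp only [e]
  rw [← ENNReal.ofReal_tsum_of_nonneg (fun _ => by positivity) h.summable, h.tsum_eq,
    ← ENNReal.ofReal_mul (by positivity), ← ofReal_integral_eq_lintegral_ofReal
    (integrableOn_I2pi_of_continuous (by fun_prop)) (ae_of_all _ fun _ => by positivity)]
  congr 1
  field_simp

/-- The critical Sobolev embedding `H^{1/4}(𝕋) ⊂ L⁴(𝕋)`. -/
lemma lintegral_pow_four_le : ∃ C : ℝ, 0 < C ∧ ∀ g : ℝ → ℂ, Continuous g →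
    (Summable fun n : ℤ => (1 + (n : ℝ) ^ 2) ^ (1 / 4 : ℝ) * ‖fc1 g n‖ ^ 2) →
    ∫⁻ x in I2pi, ‖g x‖ₑ ^ 4 ≤ ENNReal.ofReal (C * H1Sq (1 / 4) g ^ 2) := by
  refine ⟨2000 * π, by positivity, fun g hg hs => ?_⟩
  have hW : ∀ n : ℤ, 1 ≤ (1 + (n : ℝ) ^ 2) ^ (1 / 4 : ℝ) := fun n =>
    Real.one_le_rpow (by nlinarith [sq_nonneg (n : ℝ)]) (by norm_num)
  set W : ℤ → ℝ := fun n => (1 + (n : ℝ) ^ 2) ^ (1 / 4 : ℝ)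
  have e : ∀ z : ℂ, ‖z‖ₑ ^ 2 = ENNReal.ofReal (‖z‖ ^ 2) := fun z => by
    rw [ENNReal.ofReal_pow (norm_nonneg _), ofReal_norm]
  have e4 : ∀ z : ℂ, ‖z‖ₑ ^ 4 = ENNReal.ofReal (‖z‖ ^ 4) := fun z => by
    rw [ENNReal.ofReal_pow (norm_nonneg _), ofReal_norm]
  have hH : 0 ≤ H1Sq (1 / 4) g := tsum_nonneg fun n => by positivity
  have hsum : ∑' n, ENNReal.ofReal (W n) * ‖fc1 g n‖ₑ ^ 2 = ENNReal.ofReal (H1Sq (1 / 4) g) := by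
    rw [H1Sq, ENNReal.ofReal_tsum_of_nonneg (fun _ => by positivity) hs]
    exact tsum_congr fun n => by rw [ENNReal.ofReal_mul (by positivity), e]
  have hsum1 : ∑' n, ‖fc1 g n‖ₑ ^ 2 ≤ ENNReal.ofReal (H1Sq (1 / 4) g) := by
    rw [← hsum]
    refine ENNReal.tsum_le_tsum fun n => le_mul_of_one_le_left zero_le ?_
    rw [← ENNReal.ofReal_one]; exact ENNReal.ofReal_le_ofReal (hW n)
  have hL2 : ∫⁻ x in I2pi, ‖g x‖ₑ ^ 2 ≤ ENNReal.ofReal (2 * π * H1Sq (1 / 4) g) := by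
    rw [lintegral_enorm_sq_eq hg, ENNReal.ofReal_mul (q := H1Sq (1 / 4) g) (by positivity)]
    exact mul_le_mul_right hsum1 _
  rcases hH.eq_or_lt with h0 | hpos
  · rw [← h0] at hL2
    simp only [mul_zero, ENNReal.ofReal_zero, nonpos_iff_eq_zero] at hL2
    rw [lintegral_eq_zero_iff (by fun_prop)] at hL2
    rw [lintegral_congr_ae (g := fun _ => 0)]
    · simp
    · filter_upwards [hL2] with x hx
      simpa using hx
  set H := H1Sq (1 / 4) g
  have hM : 0 < √(5 * H) := by positivity
  set R : ℕ → ℝ → ℂ := fun j x => g x - partialFourier g (16 ^ j) x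
  have hRc : ∀ j, Continuous (R j) := fun j => hg.sub (continuous_partialFourier g _)
  have hpt : ∀ x, ‖g x‖ₑ ^ 4 ≤ ENNReal.ofReal (20 * H) * ‖g x‖ₑ ^ 2 +
      ENNReal.ofReal (320 * H) * ∑' j : ℕ, ENNReal.ofReal (4 ^ j) * ‖R j x‖ₑ ^ 2 := by
    intro x
    have hM2 : √(5 * H) ^ 2 = 5 * H := Real.sq_sqrt (by positivity)
    rcases pow_four_le_of_dyadic (norm_nonneg (g x)) hM (r := fun j => ‖R j x‖) (fun j => by
      have h1 := norm_partialFourier_le hs j x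
      have h2 : g x = R j x + partialFourier g (16 ^ j) x := by simp [R]
      rw [h2]
      exact (norm_add_le _ _).trans (by gcongr)) with h | ⟨j, h⟩
    · refine le_add_right ?_
      rw [e4, e, ← ENNReal.ofReal_mul (by positivity)]
      refine ENNReal.ofReal_le_ofReal (h.trans_eq ?_)
      rw [hM2]; ring
    · refine le_add_left ?_
      refine le_trans ?_ (mul_le_mul_right (ENNReal.le_tsum j) _)
      rw [e4, e, ← ENNReal.ofReal_mul (by positivity), ← ENNReal.ofReal_mul (by positivity)]
      refine ENNReal.ofReal_le_ofReal (h.trans_eq ?_)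
      rw [hM2]; ring
  have htail : ∀ j, ∫⁻ x in I2pi, ‖R j x‖ₑ ^ 2 ≤ ENNReal.ofReal (2 * π) *
      ∑' n, (if (4 : ℝ) ^ j < W n then ‖fc1 g n‖ₑ ^ 2 else 0) := by
    intro j
    rw [lintegral_enorm_sq_eq (hRc j)]
    gcongr with n
    rw [fc1_sub hg (continuous_partialFourier g _), fc1_partialFourier]
    split_ifs with h1 h2 h2
    · simp
    · simp
    · simp
    · exfalso
      apply h2
      simp only [Finset.mem_Icc, not_and_or, not_le] at h1
      have h3 : (16 : ℝ) ^ j < |(n : ℝ)| := by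
        rw [lt_abs]
        rcases h1 with h1 | h1
        · right
          have : (n : ℝ) < -((16 ^ j : ℕ) : ℝ) := by exact_mod_cast h1
          push_cast at this; linarith
        · left
          have : ((16 ^ j : ℕ) : ℝ) < n := by exact_mod_cast h1
          push_cast at this; linarith
      have h4 : (16 : ℝ) ^ j * 16 ^ j < 1 + (n : ℝ) ^ 2 := by
        have : (0 : ℝ) < 16 ^ j := by positivity
        have := sq_abs (n : ℝ)
        nlinarith
      have h5 : (4 : ℝ) ^ j = ((16 : ℝ) ^ j * 16 ^ j) ^ (1 / 4 : ℝ) := by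
        rw [← mul_pow, show (16 * 16 : ℝ) = 4 ^ 4 by norm_num, ← pow_mul, mul_comm, pow_mul,
          ← Real.rpow_natCast (_ ^ j) 4, ← Real.rpow_mul (by positivity)]
        norm_num
      rw [h5]
      exact Real.rpow_lt_rpow (by positivity) h4 (by norm_num)
  have hswap : ∑' j : ℕ, ENNReal.ofReal (4 ^ j) *
      ∑' n, (if (4 : ℝ) ^ j < W n then ‖fc1 g n‖ₑ ^ 2 else 0) ≤ ENNReal.ofReal (2 * H) := by
    simp only [← ENNReal.tsum_mul_left]
    rw [ENNReal.tsum_comm]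
    calc _ ≤ ∑' n, ENNReal.ofReal 2 * (ENNReal.ofReal (W n) * ‖fc1 g n‖ₑ ^ 2) := by
          refine ENNReal.tsum_le_tsum fun n => ?_
          have : ∀ j : ℕ, ENNReal.ofReal (4 ^ j) * (if (4 : ℝ) ^ j < W n then ‖fc1 g n‖ₑ ^ 2 else 0) =
              ENNReal.ofReal (if (4 : ℝ) ^ j < W n then 4 ^ j else 0) * ‖fc1 g n‖ₑ ^ 2 := by
            intro j; split_ifs <;> simp
          simp only [this]
          rw [ENNReal.tsum_mul_right, ← mul_assoc]
          gcongr
          refine ENNReal.tsum_le_of_sum_range_le fun J => ?_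
          rw [← ENNReal.ofReal_sum_of_nonneg (fun j _ => by split_ifs <;> positivity),
            ← ENNReal.ofReal_mul (by norm_num)]
          exact ENNReal.ofReal_le_ofReal
            (sum_range_ite_four_pow_le (zero_le_one.trans (hW n)) J)
      _ = _ := by rw [ENNReal.tsum_mul_left, hsum, ← ENNReal.ofReal_mul (by norm_num)]
  calc ∫⁻ x in I2pi, ‖g x‖ₑ ^ 4 ≤ ∫⁻ x in I2pi, (ENNReal.ofReal (20 * H) * ‖g x‖ₑ ^ 2 +
      ENNReal.ofReal (320 * H) * ∑' j : ℕ, ENNReal.ofReal (4 ^ j) * ‖R j x‖ₑ ^ 2) :=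
        lintegral_mono hpt
    _ = ENNReal.ofReal (20 * H) * (∫⁻ x in I2pi, ‖g x‖ₑ ^ 2) +
      ENNReal.ofReal (320 * H) * ∑' j : ℕ, ENNReal.ofReal (4 ^ j) *
        ∫⁻ x in I2pi, ‖R j x‖ₑ ^ 2 := by
        have hm : ∀ j, Measurable fun x => ‖R j x‖ₑ ^ 2 := fun j =>
          (hRc j).measurable.enorm.pow_const 2
        have hgm : Measurable fun x => ‖g x‖ₑ ^ 2 := hg.measurable.enorm.pow_const 2
        rw [lintegral_add_left (hgm.const_mul _), lintegral_const_mul _ hgm, lintegral_const_mul _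
          (Measurable.tsum fun j => (hm j).const_mul _),
          lintegral_tsum fun j => ((hm j).const_mul _).aemeasurable]
        congr 3
        funext j
        rw [lintegral_const_mul _ (hm j)]
    _ ≤ ENNReal.ofReal (20 * H) * ENNReal.ofReal (2 * π * H) +
      ENNReal.ofReal (320 * H) * ∑' j : ℕ, ENNReal.ofReal (2 * π) * (ENNReal.ofReal (4 ^ j) *
        ∑' n, (if (4 : ℝ) ^ j < W n then ‖fc1 g n‖ₑ ^ 2 else 0)) := by
        refine add_le_add (mul_le_mul_right hL2 _)
          (mul_le_mul_right (ENNReal.tsum_le_tsum fun j => ?_) _)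
        rw [mul_left_comm]
        exact mul_le_mul_right (htail j) _
    _ ≤ ENNReal.ofReal (20 * H) * ENNReal.ofReal (2 * π * H) +
      ENNReal.ofReal (320 * H) * (ENNReal.ofReal (2 * π) * ENNReal.ofReal (2 * H)) := by
        rw [ENNReal.tsum_mul_left]
        gcongr
    _ ≤ _ := by
        rw [← ENNReal.ofReal_mul (by positivity), ← ENNReal.ofReal_mul (by positivity),
          ← ENNReal.ofReal_mul (by positivity), ← ENNReal.ofReal_add (by positivity) (by positivity)]
        refine ENNReal.ofReal_le_ofReal ?_
        have : 0 ≤ π * H ^ 2 := by positivity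
        nlinarith

/-- Backward difference `ψ(z - δ) - ψ(z)`. -/
def bdiff (δ : ℝ) (ψ : ℝ → ℝ) (z : ℝ) : ℝ := ψ (z - δ) - ψ z

lemma contDiff_bdiff {δ : ℝ} {ψ : ℝ → ℝ} (h : ContDiff ℝ (⊤ : ℕ∞) ψ) :
    ContDiff ℝ (⊤ : ℕ∞) (bdiff δ ψ) := by
  unfold bdiff; fun_prop

lemma deriv_bdiff {δ : ℝ} {ψ : ℝ → ℝ} (h : ContDiff ℝ (⊤ : ℕ∞) ψ) :
    deriv (bdiff δ ψ) = bdiff δ (deriv ψ) := by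
  have hd : Differentiable ℝ ψ := h.differentiable (by simp)
  funext z
  have h1 : HasDerivAt (fun z => ψ (z - δ)) (deriv ψ (z - δ)) z :=
    (hd (z - δ)).hasDerivAt.comp_sub_const z δ
  exact (h1.sub (hd z).hasDerivAt).deriv

lemma contDiff_deriv {ψ : ℝ → ℝ} (h : ContDiff ℝ (⊤ : ℕ∞) ψ) :
    ContDiff ℝ (⊤ : ℕ∞) (deriv ψ) :=
  (contDiff_infty_iff_deriv.1 h).2

lemma contDiff_bdiff_iterate {δ : ℝ} (i : ℕ) {ψ : ℝ → ℝ} (h : ContDiff ℝ (⊤ : ℕ∞) ψ) :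
    ContDiff ℝ (⊤ : ℕ∞) ((bdiff δ)^[i] ψ) := by
  induction i generalizing ψ with
  | zero => exact h
  | succ i ih => exact ih (contDiff_bdiff h)

lemma deriv_bdiff_iterate {δ : ℝ} (i : ℕ) {ψ : ℝ → ℝ} (h : ContDiff ℝ (⊤ : ℕ∞) ψ) :
    deriv ((bdiff δ)^[i] ψ) = (bdiff δ)^[i] (deriv ψ) := by
  induction i generalizing ψ with
  | zero => rfl
  | succ i ih =>
    rw [Function.iterate_succ_apply, Function.iterate_succ_apply, ih (contDiff_bdiff h),
      deriv_bdiff h]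

lemma abs_bdiff_le {δ M : ℝ} (hδ : 0 ≤ δ) {ψ : ℝ → ℝ} (h : ContDiff ℝ (⊤ : ℕ∞) ψ)
    (hM : ∀ z, |deriv ψ z| ≤ M) (z : ℝ) : |bdiff δ ψ z| ≤ δ * M := by
  have hd : Differentiable ℝ ψ := h.differentiable (by simp)
  have := Convex.norm_image_sub_le_of_norm_deriv_le (f := ψ) (s := univ) (C := M) (x := z)
    (y := z - δ) (fun x _ => hd x) (fun x _ => hM x) convex_univ (mem_univ _) (mem_univ _)
  rw [show z - δ - z = -δ by ring, norm_neg, Real.norm_of_nonneg hδ, mul_comm] at this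
  exact this

lemma abs_bdiff_iterate_le {δ M : ℝ} (hδ : 0 ≤ δ) (i : ℕ) {ψ : ℝ → ℝ}
    (h : ContDiff ℝ (⊤ : ℕ∞) ψ) (hM : ∀ z, |deriv^[i] ψ z| ≤ M) (z : ℝ) :
    |(bdiff δ)^[i] ψ z| ≤ δ ^ i * M := by
  induction i generalizing ψ z with
  | zero => simpa using hM z
  | succ i ih =>
    rw [Function.iterate_succ_apply', pow_succ', mul_assoc]
    refine abs_bdiff_le hδ (contDiff_bdiff_iterate i h) (fun w => ?_) z
    rw [deriv_bdiff_iterate i h]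
    exact ih (contDiff_deriv h) hM w

lemma bdiff_iterate_eq_zero {δ R : ℝ} (hδ : 0 ≤ δ) (i : ℕ) {ψ : ℝ → ℝ}
    (hψ : ∀ z, R < |z| → ψ z = 0) (z : ℝ) (hz : R + i * δ < |z|) : (bdiff δ)^[i] ψ z = 0 := by
  induction i generalizing z with
  | zero => exact hψ z (by simpa using hz)
  | succ i ih =>
    push_cast at hz
    rw [Function.iterate_succ_apply', bdiff, ih, ih, sub_zero]
    · nlinarith
    · have : |z| ≤ |z - δ| + |δ| := by simpa using abs_add_le (z - δ) δ
      rw [abs_of_nonneg hδ] at this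
      nlinarith

/-- The trigonometric series with coefficients `c`. -/
def trigSum (c : ℤ → ℂ) (t : ℝ) : ℂ := ∑' n : ℤ, c n * Complex.exp (Complex.I * ((n : ℂ) * (t : ℂ)))

lemma summable_trig {c : ℤ → ℂ} (hc : c.support.Finite) (t : ℝ) :
    Summable fun n : ℤ => c n * Complex.exp (Complex.I * ((n : ℂ) * (t : ℂ))) :=
  summable_of_hasFiniteSupport (hc.subset fun n hn => by
    simp only [Function.mem_support] at hn ⊢
    exact left_ne_zero_of_mul hn)

lemma exp_sub_one_mul_trigSum {c : ℤ → ℂ} (hc : c.support.Finite) (t : ℝ) :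
    (Complex.exp (Complex.I * t) - 1) * trigSum c t = trigSum (fun n => c (n - 1) - c n) t := by
  have h1 : Complex.exp (Complex.I * t) * trigSum c t =
      ∑' n : ℤ, c (n - 1) * Complex.exp (Complex.I * ((n : ℂ) * (t : ℂ))) := by
    rw [← (Equiv.addRight (1 : ℤ)).tsum_eq, trigSum, ← tsum_mul_left]
    refine tsum_congr fun n => ?_
    simp only [Equiv.coe_addRight, add_sub_cancel_right]
    rw [mul_left_comm, ← Complex.exp_add]
    congr 2
    push_cast; ring
  have hc' : (fun n => c (n - 1)).support.Finite := by
    have := hc.preimage (f := fun n : ℤ => n - 1) (sub_left_injective.injOn)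
    exact this
  rw [sub_mul, h1, one_mul, trigSum, trigSum, ← (summable_trig hc' t).tsum_sub (summable_trig hc t)]
  exact tsum_congr fun n => by ring

lemma support_dilate_finite {R N : ℝ} (hN : 0 < N) {ψ : ℝ → ℝ} (hψ : ∀ z, R < |z| → ψ z = 0) :
    (fun n : ℤ => ((ψ (n / N) : ℝ) : ℂ)).support.Finite := by
  refine (Set.finite_Icc (-⌈R * N⌉) ⌈R * N⌉).subset fun n hn => ?_
  have h1 : |(n : ℝ) / N| ≤ R := by
    by_contra h
    exact hn (by simp [hψ _ (not_le.1 h)])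
  rw [abs_div, abs_of_pos hN, div_le_iff₀ hN] at h1
  rw [mem_Icc, ← abs_le]
  exact_mod_cast (show (|n| : ℝ) ≤ ⌈R * N⌉ from h1.trans (Int.le_ceil _))

lemma norm_trigSum_le {R N M : ℝ} (hR : 0 ≤ R) (hN : 1 ≤ N) (hM0 : 0 ≤ M) {ψ : ℝ → ℝ}
    (hψ : ∀ z, R < |z| → ψ z = 0) (hM : ∀ z, |ψ z| ≤ M) (t : ℝ) :
    ‖trigSum (fun n => ((ψ (n / N) : ℝ) : ℂ)) t‖ ≤ (2 * R + 1) * N * M := by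
  have hN0 : 0 < N := by linarith
  have hS : ∀ n ∉ Finset.Icc (-⌊R * N⌋) ⌊R * N⌋,
      ((ψ (n / N) : ℝ) : ℂ) * Complex.exp (Complex.I * ((n : ℂ) * (t : ℂ))) = 0 := by
    intro n hn
    rw [hψ, Complex.ofReal_zero, zero_mul]
    rw [abs_div, abs_of_pos hN0, lt_div_iff₀ hN0]
    by_contra h
    apply hn
    rw [Finset.mem_Icc, ← abs_le, Int.le_floor]
    push_cast
    exact not_lt.1 h
  rw [trigSum, tsum_eq_sum hS]
  refine (norm_sum_le_of_le _ (f := fun n : ℤ => ((ψ (n / N) : ℝ) : ℂ) * Complex.exp (Complex.I * ((n : ℂ) * (t : ℂ)))) (n := fun _ => M) fun n _ => ?_).trans ?_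
  · rw [norm_mul, norm_exp_I_int_mul, mul_one]
    simpa using hM _
  rw [Finset.sum_const, nsmul_eq_mul, Int.card_Icc]
  gcongr
  have h0 : 0 ≤ ⌊R * N⌋ := Int.floor_nonneg.2 (by positivity)
  have h1 : (((⌊R * N⌋ + 1 - -⌊R * N⌋).toNat : ℤ) : ℝ) = 2 * ⌊R * N⌋ + 1 := by
    rw [Int.toNat_of_nonneg (by linarith)]; push_cast; ring
  have h2 := Int.floor_le (R * N)
  have h3 : (((⌊R * N⌋ + 1 - -⌊R * N⌋).toNat : ℕ) : ℝ) = 2 * ⌊R * N⌋ + 1 := by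
    rw [← h1]; norm_cast
  rw [h3]
  nlinarith

lemma exp_sub_one_pow_mul_trigSum {R N : ℝ} (hN : 0 < N) {ψ : ℝ → ℝ}
    (hψ : ∀ z, R < |z| → ψ z = 0) (i : ℕ) (t : ℝ) :
    (Complex.exp (Complex.I * t) - 1) ^ i * trigSum (fun n => ((ψ (n / N) : ℝ) : ℂ)) t =
      trigSum (fun n => (((bdiff N⁻¹)^[i] ψ (n / N) : ℝ) : ℂ)) t := by
  induction i with
  | zero => simp
  | succ i ih =>
    rw [pow_succ', mul_assoc, ih, exp_sub_one_mul_trigSum (support_dilate_finite hN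
      (bdiff_iterate_eq_zero (inv_nonneg.2 hN.le) i hψ))]
    congr 1
    funext n
    rw [Function.iterate_succ_apply', bdiff]
    push_cast
    congr 4
    field_simp

lemma abs_le_two_mul_norm_exp_sub_one {t : ℝ} (ht : |t| ≤ π) :
    |t| ≤ 2 * ‖Complex.exp (Complex.I * t) - 1‖ := by
  rw [Complex.norm_exp_I_mul_ofReal_sub_one, norm_mul]
  have := Real.mul_abs_le_abs_sin (x := t / 2) (by rw [abs_div]; norm_num; linarith)
  rw [abs_div, abs_two] at this
  have h4 := Real.pi_le_four
  have h5 : |t| / 4 ≤ 2 / π * (|t| / 2) := by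
    rw [div_mul_div_comm, div_le_div_iff₀ (by norm_num) (by positivity)]
    nlinarith [abs_nonneg t]
  simp only [Real.norm_eq_abs, abs_two]
  linarith

lemma exists_trigSum_kernel_bound {R : ℝ} (hR : 0 < R) {ψ : ℝ → ℝ} (h : ContDiff ℝ (⊤ : ℕ∞) ψ)
    (hψ : ∀ z, R < |z| → ψ z = 0) : ∃ K : ℝ, 0 < K ∧ ∀ N : ℝ, 1 ≤ N → ∀ t : ℝ, |t| ≤ π →
      |t| * ‖trigSum (fun n => ((ψ (n / N) : ℝ) : ℂ)) t‖ ≤ K * (1 + (N * t) ^ 2)⁻¹ := by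
  have hcs : HasCompactSupport ψ := HasCompactSupport.of_support_subset_isCompact
    (isCompact_Icc (a := -R) (b := R)) fun z hz => by
      rw [mem_Icc, ← abs_le]
      by_contra hc
      exact hz (hψ z (not_le.1 hc))
  have h1 := contDiff_deriv h
  have h3 := contDiff_deriv (contDiff_deriv h1)
  obtain ⟨M1, hM1⟩ := hcs.deriv.exists_bound_of_continuous h1.continuous
  obtain ⟨M3, hM3⟩ := hcs.deriv.deriv.deriv.exists_bound_of_continuous h3.continuous
  have hM10 : 0 ≤ M1 := (norm_nonneg _).trans (hM1 0)
  have hM30 : 0 ≤ M3 := (norm_nonneg _).trans (hM3 0)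
  refine ⟨(2 * (R + 3) + 1) * (2 * M1 + 8 * M3) + 1, by positivity, fun N hN t ht => ?_⟩
  have hN0 : 0 < N := by linarith
  have hNi : N⁻¹ ≤ 1 := inv_le_one_of_one_le₀ hN
  have hNi0 : 0 ≤ N⁻¹ := inv_nonneg.2 hN0.le
  set P := ‖trigSum (fun n => ((ψ (n / N) : ℝ) : ℂ)) t‖ with hP
  have hP0 : 0 ≤ P := norm_nonneg _
  set E := ‖Complex.exp (Complex.I * t) - 1‖
  have key : ∀ (i : ℕ) (M : ℝ), 0 ≤ M → i ≤ 3 → (∀ z, |deriv^[i] ψ z| ≤ M) →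
      E ^ i * P ≤ (2 * (R + 3) + 1) * N * (N⁻¹ ^ i * M) := by
    intro i M hM hi hb
    rw [hP, ← norm_pow, ← norm_mul, exp_sub_one_pow_mul_trigSum hN0 hψ]
    refine norm_trigSum_le (by positivity) hN (by positivity) (fun z hz => ?_)
      (abs_bdiff_iterate_le hNi0 i h hb) t
    refine bdiff_iterate_eq_zero hNi0 i hψ z (lt_of_le_of_lt ?_ hz)
    have : (i : ℝ) ≤ 3 := by exact_mod_cast hi
    nlinarith
  have k1 := key 1 M1 hM10 (by norm_num) hM1
  have k3 := key 3 M3 hM30 (by norm_num) hM3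
  have hE := abs_le_two_mul_norm_exp_sub_one ht
  have e1 : |t| * P ≤ (2 * (R + 3) + 1) * (2 * M1) := by
    calc |t| * P ≤ 2 * E * P := by gcongr
      _ = 2 * (E ^ 1 * P) := by ring
      _ ≤ 2 * ((2 * (R + 3) + 1) * N * (N⁻¹ ^ 1 * M1)) := by gcongr
      _ = _ := by field_simp
  have e3 : |t| * P * (N * t) ^ 2 ≤ (2 * (R + 3) + 1) * (8 * M3) := by
    calc |t| * P * (N * t) ^ 2 = N ^ 2 * (|t| ^ 3 * P) := by
          rw [mul_pow, ← sq_abs t]; ring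
      _ ≤ N ^ 2 * ((2 * E) ^ 3 * P) := by gcongr
      _ = N ^ 2 * (8 * (E ^ 3 * P)) := by ring
      _ ≤ N ^ 2 * (8 * ((2 * (R + 3) + 1) * N * (N⁻¹ ^ 3 * M3))) := by gcongr
      _ = _ := by field_simp
  rw [← div_eq_mul_inv, le_div_iff₀ (by positivity)]
  linarith

/-- The convolution kernel of the vertical Fourier multiplier with symbol `m`, where `m` vanishes
at the integers outside `S`. -/
def trigKer (m : ℝ → ℝ) (S : Finset ℤ) (t : ℝ) : ℂ :=
  (1 / (2 * π) : ℂ) * ∑ n ∈ S, (m n : ℂ) * Complex.exp (Complex.I * ((n : ℂ) * (t : ℂ)))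

lemma contDiff_trigKer (m : ℝ → ℝ) (S : Finset ℤ) : ContDiff ℝ (⊤ : ℕ∞) (trigKer m S) := by
  have : ∀ n : ℤ, ContDiff ℝ (⊤ : ℕ∞) fun t : ℝ => Complex.exp (Complex.I * ((n : ℂ) * (t : ℂ))) :=
    fun n => (contDiff_const.mul (contDiff_const.mul Complex.ofRealCLM.contDiff)).cexp
  unfold trigKer
  exact contDiff_const.mul (ContDiff.sum fun n _ => contDiff_const.mul (this n))

lemma trigKer_periodic (m : ℝ → ℝ) (S : Finset ℤ) : Function.Periodic (trigKer m S) (2 * π) := by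
  intro t
  unfold trigKer
  congr 1
  refine Finset.sum_congr rfl fun n _ => ?_
  congr 1
  rw [Complex.exp_eq_exp_iff_exists_int]
  exact ⟨n, by push_cast; ring⟩

lemma exists_lintegral_kernel_bound {R : ℝ} (hR : 0 < R) {ψ : ℝ → ℝ}
    (h : ContDiff ℝ (⊤ : ℕ∞) ψ) (hψ : ∀ z, R < |z| → ψ z = 0) :
    ∃ K : ℝ, 0 < K ∧ ∀ N : ℝ, 1 ≤ N → ∀ (m : ℝ → ℝ) (S : Finset ℤ),
      (∀ n : ℤ, m n = ψ (n / N)) → (∀ n : ℤ, n ∉ S → m n = 0) →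
      ∫⁻ t in Ioc (-π) π, ‖t‖ₑ * ‖trigKer m S t‖ₑ ≤ ENNReal.ofReal (K / N) := by
  obtain ⟨K, hK, hb⟩ := exists_trigSum_kernel_bound hR h hψ
  refine ⟨K, hK, fun N hN m S hm hS => ?_⟩
  have hN0 : 0 < N := by linarith
  have hk : ∀ t, trigKer m S t =
      (1 / (2 * π) : ℂ) * trigSum (fun n => ((ψ (n / N) : ℝ) : ℂ)) t := by
    intro t
    rw [trigKer, trigSum]
    congr 1
    rw [tsum_eq_sum (s := S)]
    · exact Finset.sum_congr rfl fun n _ => by rw [hm]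
    · intro n hn; rw [← hm, hS n hn]; simp
  have hint : Integrable fun t : ℝ => K / (2 * π) * (1 + (N * t) ^ 2)⁻¹ :=
    ((integrable_inv_one_add_sq).comp_mul_left' hN0.ne').const_mul _
  calc ∫⁻ t in Ioc (-π) π, ‖t‖ₑ * ‖trigKer m S t‖ₑ
      ≤ ∫⁻ t in Ioc (-π) π, ENNReal.ofReal (K / (2 * π) * (1 + (N * t) ^ 2)⁻¹) := by
        refine setLIntegral_mono' measurableSet_Ioc fun t ht => ?_
        rw [← ofReal_norm, ← ofReal_norm, ← ENNReal.ofReal_mul (norm_nonneg _)]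
        refine ENNReal.ofReal_le_ofReal ?_
        have := hb N hN t (abs_le.2 ⟨ht.1.le, ht.2⟩)
        rw [hk, norm_mul]
        have e : ‖(1 / (2 * π) : ℂ)‖ = (2 * π)⁻¹ := by simp [abs_of_pos Real.pi_pos]
        rw [e, Real.norm_eq_abs]
        have hp := Real.pi_pos
        calc _ = (2 * π)⁻¹ * (|t| * ‖trigSum (fun n => ((ψ (n / N) : ℝ) : ℂ)) t‖) := by ring
          _ ≤ (2 * π)⁻¹ * (K * (1 + (N * t) ^ 2)⁻¹) := by gcongr
          _ = _ := by ring
    _ ≤ ∫⁻ t, ENNReal.ofReal (K / (2 * π) * (1 + (N * t) ^ 2)⁻¹) := setLIntegral_le_lintegral _ _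
    _ = ENNReal.ofReal (∫ t, K / (2 * π) * (1 + (N * t) ^ 2)⁻¹) := by
        rw [ofReal_integral_eq_lintegral_ofReal hint (ae_of_all _ fun t => by positivity)]
    _ ≤ _ := by
        refine ENNReal.ofReal_le_ofReal ?_
        rw [integral_const_mul, Measure.integral_comp_mul_left (fun t : ℝ => (1 + t ^ 2)⁻¹) N,
          integral_univ_inv_one_add_sq, abs_of_pos (inv_pos.2 hN0), smul_eq_mul]
        have hp := Real.pi_pos
        have : K / (2 * π) * (N⁻¹ * π) = K / N / 2 := by field_simp
        rw [this]
        have : 0 < K / N := by positivity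
        linarith

lemma hasDerivAt_intervalIntegral_param {F F' : ℝ → ℝ → ℂ} (a b : ℝ)
    (hF : Continuous (Function.uncurry F)) (hF' : Continuous (Function.uncurry F'))
    (hd : ∀ x t, HasDerivAt (fun s => F s t) (F' x t) x) (x : ℝ) :
    HasDerivAt (fun s => ∫ t in a..b, F s t) (∫ t in a..b, F' x t) x := by
  obtain ⟨M, hM⟩ := ((isCompact_closedBall x 1).prod (isCompact_uIcc (a := a) (b := b))).exists_bound_of_continuousOn
    hF'.continuousOn
  have hc : ∀ s, Continuous (F s) := fun s => hF.comp (by fun_prop : Continuous fun t => (s, t))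
  have hc' : ∀ s, Continuous (F' s) := fun s => hF'.comp (by fun_prop : Continuous fun t => (s, t))
  refine (intervalIntegral.hasDerivAt_integral_of_dominated_loc_of_deriv_le
    (bound := fun _ => M) (F' := F') (Metric.closedBall_mem_nhds x one_pos)
    (Eventually.of_forall fun s => (hc s).aestronglyMeasurable)
    ((hc x).intervalIntegrable _ _) (hc' x).aestronglyMeasurable
    (ae_of_all _ fun t ht s hs => ?_) intervalIntegrable_const
    (ae_of_all _ fun t _ s _ => hd s t)).2
  exact hM (s, t) ⟨hs, uIoc_subset_uIcc ht⟩

/-- Continuous doubly periodic functions that are twice continuously differentiable in the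
horizontal variable. -/
structure HReg (g : ℝ × ℝ → ℂ) : Prop where
  cont : Continuous g
  per1 : ∀ x y, g (x + 2 * π, y) = g (x, y)
  per2 : ∀ x y, g (x, y + 2 * π) = g (x, y)
  deriv : ∃ g1 g2 : ℝ × ℝ → ℂ, Continuous g1 ∧ Continuous g2 ∧
    (∀ x y, HasDerivAt (fun s => g (s, y)) (g1 (x, y)) x) ∧
    (∀ x y, HasDerivAt (fun s => g1 (s, y)) (g2 (x, y)) x)

lemma HReg.mul {g h : ℝ × ℝ → ℂ} (hg : HReg g) (hh : HReg h) : HReg fun x => g x * h x := by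
  obtain ⟨g1, g2, cg1, cg2, dg1, dg2⟩ := hg.deriv
  obtain ⟨h1, h2, ch1, ch2, dh1, dh2⟩ := hh.deriv
  have cg := hg.cont
  have ch := hh.cont
  refine ⟨cg.mul ch, fun x y => by rw [hg.per1, hh.per1], fun x y => by rw [hg.per2, hh.per2],
    fun x => g1 x * h x + g x * h1 x,
    fun x => (g2 x * h x + g1 x * h1 x) + (g1 x * h1 x + g x * h2 x), by fun_prop, by fun_prop,
    fun x y => (dg1 x y).mul (dh1 x y),
    fun x y => ((dg2 x y).mul (dh1 x y)).add ((dg1 x y).mul (dh2 x y))⟩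

lemma hasDerivAt_slice_fst {g : ℝ × ℝ → ℝ} (hg : Smooth g) (x y : ℝ) :
    HasDerivAt (fun s => g (s, y)) (pd1 g (x, y)) x :=
  (hg.differentiable (by simp) (x, y)).hasFDerivAt.comp_hasDerivAt x
    ((hasDerivAt_id x).prodMk (hasDerivAt_const x y))

lemma hasDerivAt_slice_snd {g : ℝ × ℝ → ℝ} (hg : Smooth g) (x y : ℝ) :
    HasDerivAt (fun s => g (x, s)) (pd2 g (x, y)) y :=
  (hg.differentiable (by simp) (x, y)).hasFDerivAt.comp_hasDerivAt y
    ((hasDerivAt_const y x).prodMk (hasDerivAt_id y))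

lemma Smooth.pd1 {g : ℝ × ℝ → ℝ} (hg : Smooth g) : Smooth (pd1 g) :=
  (hg.fderiv_right (m := (⊤ : ℕ∞)) le_rfl).clm_apply contDiff_const

lemma Smooth.pd2 {g : ℝ × ℝ → ℝ} (hg : Smooth g) : Smooth (pd2 g) :=
  (hg.fderiv_right (m := (⊤ : ℕ∞)) le_rfl).clm_apply contDiff_const

lemma Per.pd1 {g : ℝ × ℝ → ℝ} (hg : Smooth g) (hp : Per g) : Per (pd1 g) := by
  constructor
  · rintro ⟨x, y⟩
    have h1 := (hasDerivAt_slice_fst hg (x + 2 * π) y).comp_add_const x (2 * π)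
    simp only [fun s => hp.1 (s, y)] at h1
    exact h1.unique (hasDerivAt_slice_fst hg x y)
  · rintro ⟨x, y⟩
    have h1 := hasDerivAt_slice_fst hg x (y + 2 * π)
    simp only [fun s => hp.2 (s, y)] at h1
    exact h1.unique (hasDerivAt_slice_fst hg x y)

lemma HReg.of_smooth {g : ℝ × ℝ → ℝ} (hg : Smooth g) (hp : Per g) :
    HReg fun x => (g x : ℂ) :=
  ⟨Complex.continuous_ofReal.comp hg.continuous, fun x y => by rw [hp.1 (x, y)],
    fun x y => by rw [hp.2 (x, y)], fun x => (Aniso.pd1 g x : ℂ),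
    fun x => (Aniso.pd1 (Aniso.pd1 g) x : ℂ),
    Complex.continuous_ofReal.comp hg.pd1.continuous,
    Complex.continuous_ofReal.comp hg.pd1.pd1.continuous,
    fun x y => (hasDerivAt_slice_fst hg x y).ofReal_comp,
    fun x y => (hasDerivAt_slice_fst hg.pd1 x y).ofReal_comp⟩

lemma HReg.exists_decay {g : ℝ × ℝ → ℂ} (hg : HReg g) :
    ∃ M : ℝ, ∀ (y : ℝ) (n : ℤ), (1 + (n : ℝ) ^ 2) * ‖fc1 (fun x => g (x, y)) n‖ ≤ M := by
  obtain ⟨g1, g2, cg1, cg2, dg1, dg2⟩ := hg.deriv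
  have hK := (isCompact_Icc (a := (0 : ℝ)) (b := 2 * π)).prod (isCompact_Icc (a := (0 : ℝ)) (b := 2 * π))
  obtain ⟨M0, hM0⟩ := hK.exists_bound_of_continuousOn hg.cont.continuousOn
  obtain ⟨M2, hM2⟩ := hK.exists_bound_of_continuousOn cg2.continuousOn
  refine ⟨M0 + M2, fun y n => ?_⟩
  obtain ⟨y', hy', h⟩ : ∃ y' ∈ Ico (0 : ℝ) (2 * π), ∀ x, g (x, y) = g (x, y') := by
    have hper : Function.Periodic (fun y => fun x => g (x, y)) (2 * π) := fun y => by
      funext x; exact hg.per2 x y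
    obtain ⟨y', hy', h⟩ := hper.exists_mem_Ico₀ Real.two_pi_pos y
    exact ⟨y', hy', fun x => congrFun h x⟩
  simp only [h]
  have hy : y' ∈ Icc (0 : ℝ) (2 * π) := Ico_subset_Icc_self hy'
  have c0 : ∀ {G : ℝ × ℝ → ℂ}, Continuous G → Continuous fun x => G (x, y') := fun hG => by fun_prop
  have p0 : Function.Periodic (fun x => g (x, y')) (2 * π) := fun x => hg.per1 x y'
  have p1 : Function.Periodic (fun x => g1 (x, y')) (2 * π) := fun x => by
    have h1 := (dg1 (x + 2 * π) y').comp_add_const x (2 * π)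
    simp only [hg.per1] at h1
    exact h1.unique (dg1 x y')
  have e1 := fc1_deriv (fun x => dg1 x y') (c0 cg1) p0 n
  have e2 := fc1_deriv (fun x => dg2 x y') (c0 cg2) p1 n
  have b0 := norm_fc1_le (g := fun x => g (x, y')) (M := M0)
    (fun x hx => hM0 (x, y') ⟨Ioc_subset_Icc_self hx, hy⟩) n
  have b2 := norm_fc1_le (g := fun x => g2 (x, y')) (M := M2)
    (fun x hx => hM2 (x, y') ⟨Ioc_subset_Icc_self hx, hy⟩) n
  rw [e2, e1] at b2
  simp only [norm_mul, Complex.norm_I, one_mul, Complex.norm_intCast] at b2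
  rw [← mul_assoc, ← sq, sq_abs] at b2
  linarith

lemma summable_inv_one_add_int_sq : Summable fun n : ℤ => (1 + (n : ℝ) ^ 2)⁻¹ := by
  have h1 : Summable fun n : ℤ => 1 / (n : ℝ) ^ 2 := Real.summable_one_div_int_pow.2 one_lt_two
  have h2 : Summable fun n : ℤ => if n = 0 then (1 : ℝ) else 0 :=
    (hasSum_ite_eq 0 (1 : ℝ)).summable
  refine (h1.add h2).of_nonneg_of_le (fun n => by positivity) fun n => ?_
  rcases eq_or_ne n 0 with rfl | hn
  · simp
  · have : (0 : ℝ) < (n : ℝ) ^ 2 := by positivity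
    simp only [hn, if_false, add_zero, one_div]
    gcongr
    linarith

lemma HReg.continuous_slice {g : ℝ × ℝ → ℂ} (hg : HReg g) (y : ℝ) :
    Continuous fun x => g (x, y) := by have := hg.cont; fun_prop

lemma HReg.norm_fc1_le {g : ℝ × ℝ → ℂ} (hg : HReg g) :
    ∃ M : ℝ, ∀ (y : ℝ) (n : ℤ), ‖fc1 (fun x => g (x, y)) n‖ ≤ M * (1 + (n : ℝ) ^ 2)⁻¹ := by
  obtain ⟨M, hM⟩ := hg.exists_decay
  refine ⟨M, fun y n => ?_⟩
  rw [← div_eq_mul_inv, le_div_iff₀ (by positivity), mul_comm]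
  exact hM y n

lemma HReg.summable_fc1 {g : ℝ × ℝ → ℂ} (hg : HReg g) (y : ℝ) :
    Summable (fc1 fun x => g (x, y)) := by
  obtain ⟨M, hM⟩ := hg.norm_fc1_le
  exact Summable.of_norm_bounded (summable_inv_one_add_int_sq.mul_left M) (hM y)

lemma HReg.continuous_fc1 {g : ℝ × ℝ → ℂ} (hg : HReg g) (n : ℤ) :
    Continuous fun y => fc1 (fun x => g (x, y)) n := by
  simp only [fc1, integral_I2pi]
  have := hg.cont
  refine continuous_const.mul
    (intervalIntegral.continuous_parametric_intervalIntegral_of_continuous' ?_ _ _)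
  fun_prop

lemma HReg.fcC_eq {g : ℝ × ℝ → ℂ} (hg : HReg g) (k1 k2 : ℤ) :
    fcC g (k1, k2) = fc1 (fun y => fc1 (fun x => g (x, y)) k1) k2 := by
  have hc := hg.cont
  have hint : IntegrableOn (fun x : ℝ × ℝ => g x * Complex.exp (-(Complex.I) *
      (((k1, k2) : ℤ × ℤ).1 * (x.1 : ℂ) + ((k1, k2) : ℤ × ℤ).2 * (x.2 : ℂ)))) (I2pi ×ˢ I2pi)
      (volume.prod volume) := by
    refine IntegrableOn.mono_set (t := Icc 0 (2 * π) ×ˢ Icc 0 (2 * π)) ?_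
      (prod_mono Ioc_subset_Icc_self Ioc_subset_Icc_self)
    exact ContinuousOn.integrableOn_compact (isCompact_Icc.prod isCompact_Icc)
      (by fun_prop : Continuous _).continuousOn
  rw [fcC, Q2, Measure.volume_eq_prod, ← Measure.prod_restrict, integral_prod_symm _ (by
    rw [Measure.prod_restrict]; exact hint)]
  simp only [fc1]
  have : ∀ (c : ℂ) (F : ℝ → ℂ), c * c * ∫ y in I2pi, F y = c * ∫ y in I2pi, c * F y := by
    intro c F; rw [integral_const_mul]; ring
  rw [show (1 / (2 * π) ^ 2 : ℂ) = 1 / (2 * π) * (1 / (2 * π)) by field_simp, this]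
  congr 2
  funext y
  rw [mul_assoc, ← integral_mul_const]
  congr 2
  funext x
  rw [mul_assoc, ← Complex.exp_add]
  congr 2
  ring

/-- Vertical periodic convolution. -/
def vconv (K : ℝ → ℂ) (g : ℝ × ℝ → ℂ) (x : ℝ × ℝ) : ℂ :=
  ∫ y in I2pi, K (x.2 - y) * g (x.1, y)

lemma HReg.hasSum_fcC {g : ℝ × ℝ → ℂ} (hg : HReg g) (n : ℤ) (x : ℝ) :
    HasSum (fun k1 : ℤ => fcC g (k1, n) * Complex.exp (Complex.I * ((k1 : ℂ) * (x : ℂ))))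
      (fc1 (fun y => g (x, y)) n) := by
  obtain ⟨M, hM⟩ := hg.norm_fc1_le
  let F : ℤ → ℝ → ℂ := fun k1 y => fc1 (fun x => g (x, y)) k1 *
    Complex.exp (-(Complex.I) * ((n : ℂ) * (y : ℂ))) *
      Complex.exp (Complex.I * ((k1 : ℂ) * (x : ℂ)))
  have hFc : ∀ k1, Continuous (F k1) := fun k1 => by
    have := hg.continuous_fc1 k1
    fun_prop
  have hb : ∀ k1 y, ‖F k1 y‖ ≤ M * (1 + (k1 : ℝ) ^ 2)⁻¹ := fun k1 y => by
    simp only [F, norm_mul, norm_exp_I_int_mul, norm_exp_neg_I_int_mul, mul_one]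
    exact hM y k1
  have hs : Summable fun k1 => ∫ y in I2pi, ‖F k1 y‖ := by
    refine Summable.of_nonneg_of_le (fun k1 => integral_nonneg fun y => norm_nonneg _)
      (fun k1 => ?_) ((summable_inv_one_add_int_sq.mul_left M).mul_left (2 * π))
    calc ∫ y in I2pi, ‖F k1 y‖ ≤ ∫ y in I2pi, M * (1 + (k1 : ℝ) ^ 2)⁻¹ :=
          integral_mono (integrableOn_I2pi_of_continuous (by have := hFc k1; fun_prop))
            (integrableOn_I2pi_of_continuous continuous_const) (hb k1)
      _ = _ := by
          rw [integral_I2pi]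
          simp
          ring
  have h := hasSum_integral_of_summable_integral_norm
    (fun k1 => integrableOn_I2pi_of_continuous (hFc k1)) hs
  have hinv : ∀ y, ∑' k1, F k1 y = g (x, y) * Complex.exp (-(Complex.I) * ((n : ℂ) * (y : ℂ))) := by
    intro y
    have := (fc1_inversion (hg.continuous_slice y) (fun x => hg.per1 x y) (hg.summable_fc1 y) x).mul_right
      (Complex.exp (-(Complex.I) * ((n : ℂ) * (y : ℂ))))
    rw [← this.tsum_eq]
    exact tsum_congr fun k1 => by simp only [F]; ring
  simp only [hinv] at h
  have h' := h.mul_left (1 / (2 * π) : ℂ)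
  have e : (fun k1 : ℤ => fcC g (k1, n) * Complex.exp (Complex.I * ((k1 : ℂ) * (x : ℂ)))) =
      fun k1 => (1 / (2 * π) : ℂ) * ∫ y in I2pi, F k1 y := by
    funext k1
    rw [hg.fcC_eq, fc1, mul_assoc, ← integral_mul_const]
  rw [e]
  exact h'

lemma HReg.tsum_multiplier {g : ℝ × ℝ → ℂ} (hg : HReg g) {m : ℝ → ℝ} {S : Finset ℤ}
    (hm : ∀ n : ℤ, n ∉ S → m n = 0) (x : ℝ × ℝ) :
    ∑' k : ℤ × ℤ, (m k.2 : ℂ) * fcC g k * eK k x = vconv (trigKer m S) g x := by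
  have hn : ∀ n : ℤ, HasSum (fun k : ℤ × ℤ => if k.2 = n then (m k.2 : ℂ) * fcC g k * eK k x else 0)
      ((m n : ℂ) * Complex.exp (Complex.I * ((n : ℂ) * (x.2 : ℂ))) *
        fc1 (fun y => g (x.1, y)) n) := by
    intro n
    have hinj : Function.Injective fun k1 : ℤ => (k1, n) := fun a b h => by simpa using h
    rw [← hinj.hasSum_iff]
    · have e : ((fun k : ℤ × ℤ => if k.2 = n then (m k.2 : ℂ) * fcC g k * eK k x else 0) ∘
          fun k1 : ℤ => (k1, n)) = fun k1 : ℤ => (m n : ℂ) *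
            Complex.exp (Complex.I * ((n : ℂ) * (x.2 : ℂ))) *
              (fcC g (k1, n) * Complex.exp (Complex.I * ((k1 : ℂ) * (x.1 : ℂ)))) := by
        funext k1
        simp only [Function.comp_apply, if_true, eK]
        rw [mul_add, Complex.exp_add]
        ring
      rw [e]
      exact (hg.hasSum_fcC n x.1).mul_left _
    · intro k hk
      rw [if_neg]
      rintro rfl
      exact hk ⟨k.1, rfl⟩
  have hsum := hasSum_sum (s := S) fun n _ => hn n
  have e : (fun k : ℤ × ℤ => ∑ n ∈ S, if k.2 = n then (m k.2 : ℂ) * fcC g k * eK k x else 0) =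
      fun k => (m k.2 : ℂ) * fcC g k * eK k x := by
    funext k
    rw [Finset.sum_ite_eq]
    split_ifs with h
    · rfl
    · rw [hm _ h]; simp
  rw [e] at hsum
  rw [hsum.tsum_eq, vconv]
  have hc : Continuous fun y => g (x.1, y) := by have := hg.cont; fun_prop
  have : ∀ y, trigKer m S (x.2 - y) * g (x.1, y) = ∑ n ∈ S, (m n : ℂ) *
      Complex.exp (Complex.I * ((n : ℂ) * (x.2 : ℂ))) * (1 / (2 * π)) *
        (g (x.1, y) * Complex.exp (-(Complex.I) * ((n : ℂ) * (y : ℂ)))) := by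
    intro y
    rw [trigKer, mul_assoc, Finset.sum_mul, Finset.mul_sum]
    refine Finset.sum_congr rfl fun n _ => ?_
    rw [show Complex.I * ((n : ℂ) * ((x.2 - y : ℝ) : ℂ)) = Complex.I * ((n : ℂ) * (x.2 : ℂ)) +
      -(Complex.I) * ((n : ℂ) * (y : ℂ)) by push_cast; ring, Complex.exp_add]
    ring
  simp only [this]
  have hi : ∀ n ∈ S, IntegrableOn (fun y => (m n : ℂ) *
      Complex.exp (Complex.I * ((n : ℂ) * (x.2 : ℂ))) * (1 / (2 * π)) *
        (g (x.1, y) * Complex.exp (-(Complex.I) * ((n : ℂ) * (y : ℂ))))) I2pi := fun n _ =>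
    integrableOn_I2pi_of_continuous (continuous_const.mul (hc.mul (by fun_prop)))
  rw [integral_finsetSum _ hi]
  refine Finset.sum_congr rfl fun n _ => ?_
  rw [integral_const_mul, fc1]
  ring

lemma continuous_vconv {K : ℝ → ℂ} (hK : Continuous K) {g : ℝ × ℝ → ℂ} (hg : Continuous g) :
    Continuous (vconv K g) := by
  unfold vconv
  simp only [integral_I2pi]
  refine intervalIntegral.continuous_parametric_intervalIntegral_of_continuous' ?_ _ _
  fun_prop

lemma HReg.vconv {K : ℝ → ℂ} (hK : Continuous K) (hKp : Function.Periodic K (2 * π))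
    {g : ℝ × ℝ → ℂ} (hg : HReg g) : HReg (vconv K g) := by
  obtain ⟨g1, g2, cg1, cg2, dg1, dg2⟩ := hg.deriv
  have key : ∀ {G G' : ℝ × ℝ → ℂ}, Continuous G → Continuous G' →
      (∀ x y, HasDerivAt (fun s => G (s, y)) (G' (x, y)) x) →
      ∀ x y, HasDerivAt (fun s => Aniso.vconv K G (s, y)) (Aniso.vconv K G' (x, y)) x := by
    intro G G' hG hG' hd x y
    simp only [Aniso.vconv, integral_I2pi]
    exact hasDerivAt_intervalIntegral_param (F := fun s t => K (y - t) * G (s, t))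
      (F' := fun s t => K (y - t) * G' (s, t)) _ _ (by fun_prop) (by fun_prop)
      (fun x t => (hd x t).const_mul _) x
  refine ⟨continuous_vconv hK hg.cont, fun x y => ?_, fun x y => ?_, Aniso.vconv K g1,
    Aniso.vconv K g2, continuous_vconv hK cg1, continuous_vconv hK cg2,
    key hg.cont cg1 dg1, key cg1 cg2 dg2⟩
  · simp only [Aniso.vconv, hg.per1]
  · simp only [Aniso.vconv]
    congr 1
    funext t
    rw [show y + 2 * π - t = y - t + 2 * π by ring, hKp]

lemma vconv_eq_shift {K : ℝ → ℂ} (hKp : Function.Periodic K (2 * π)) {g : ℝ × ℝ → ℂ}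
    (hg : ∀ x y, g (x, y + 2 * π) = g (x, y)) (x : ℝ × ℝ) :
    vconv K g x = ∫ t in (-π)..π, K t * g (x.1, x.2 - t) := by
  have hper : Function.Periodic (fun t => K t * g (x.1, x.2 - t)) (2 * π) := fun t => by
    have h1 := hg x.1 (x.2 - (t + 2 * π))
    rw [show x.2 - (t + 2 * π) + 2 * π = x.2 - t by ring] at h1
    simp only [hKp t, h1]
  rw [vconv, integral_I2pi]
  have h := intervalIntegral.integral_comp_sub_left (a := 0) (b := 2 * π)
    (fun t => K t * g (x.1, x.2 - t)) x.2
  simp only [sub_sub_cancel] at h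
  rw [h]
  have := hper.intervalIntegral_add_eq (x.2 - 2 * π) (-π)
  rw [show x.2 - 2 * π + 2 * π = x.2 - 0 by ring, show -π + 2 * π = π by ring] at this
  exact this

lemma hasDerivAt_vconv_snd {K : ℝ → ℂ} (hK : Continuous K) (hKp : Function.Periodic K (2 * π))
    {g g' : ℝ × ℝ → ℂ} (hg : Continuous g) (hg' : Continuous g')
    (hp : ∀ x y, g (x, y + 2 * π) = g (x, y)) (hp' : ∀ x y, g' (x, y + 2 * π) = g' (x, y))
    (hd : ∀ x y, HasDerivAt (fun s => g (x, s)) (g' (x, y)) y) (x y : ℝ) :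
    HasDerivAt (fun s => vconv K g (x, s)) (vconv K g' (x, y)) y := by
  simp only [vconv_eq_shift hKp hp, vconv_eq_shift hKp hp']
  exact hasDerivAt_intervalIntegral_param (F := fun s t => K t * g (x, s - t))
    (F' := fun s t => K t * g' (x, s - t)) _ _ (by fun_prop) (by fun_prop)
    (fun y t => ((hd x (y - t)).comp_sub_const y t).const_mul _) y

lemma HReg.summable_H1Sq {g : ℝ × ℝ → ℂ} (hg : HReg g) :
    (∀ y, Summable fun n : ℤ => (1 + (n : ℝ) ^ 2) ^ (1 / 4 : ℝ) * ‖fc1 (fun x => g (x, y)) n‖ ^ 2) ∧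
      Continuous fun y => H1Sq (1 / 4) fun x => g (x, y) := by
  obtain ⟨M, hM⟩ := hg.norm_fc1_le
  have hb : ∀ (y : ℝ) (n : ℤ),
      ‖(1 + (n : ℝ) ^ 2) ^ (1 / 4 : ℝ) * ‖fc1 (fun x => g (x, y)) n‖ ^ 2‖ ≤
        M ^ 2 * (1 + (n : ℝ) ^ 2)⁻¹ := by
    intro y n
    have hw : 1 ≤ 1 + (n : ℝ) ^ 2 := by nlinarith [sq_nonneg (n : ℝ)]
    have h1 : (1 + (n : ℝ) ^ 2) ^ (1 / 4 : ℝ) ≤ 1 + (n : ℝ) ^ 2 := by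
      simpa using Real.rpow_le_rpow_of_exponent_le hw (show (1 / 4 : ℝ) ≤ 1 by norm_num)
    rw [Real.norm_of_nonneg (by positivity)]
    calc _ ≤ (1 + (n : ℝ) ^ 2) * (M * (1 + (n : ℝ) ^ 2)⁻¹) ^ 2 := by
          gcongr
          exact hM y n
      _ = _ := by field_simp
  have hs := summable_inv_one_add_int_sq.mul_left (M ^ 2)
  refine ⟨fun y => Summable.of_norm_bounded hs (hb y), ?_⟩
  unfold H1Sq
  refine continuous_tsum (fun n => ?_) hs fun n y => hb y n
  have := hg.continuous_fc1 n
  fun_prop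

lemma lintegral_rpow_le_measure_univ_rpow_mul {α : Type*} [MeasurableSpace α] (ν : Measure α)
    {p q : ℝ} (hpq : p.HolderConjugate q) {G : α → ENNReal} (hG : AEMeasurable G ν) :
    (∫⁻ t, G t ∂ν) ^ p ≤ ν univ ^ (p / q) * ∫⁻ t, G t ^ p ∂ν := by
  have h := ENNReal.lintegral_mul_le_Lp_mul_Lq ν hpq hG (aemeasurable_const (b := (1 : ENNReal)))
  simp only [Pi.mul_apply, mul_one, ENNReal.one_rpow, lintegral_const, one_mul] at h
  calc (∫⁻ t, G t ∂ν) ^ p ≤ ((∫⁻ t, G t ^ p ∂ν) ^ (1 / p) * ν univ ^ (1 / q)) ^ p :=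
        ENNReal.rpow_le_rpow h hpq.nonneg
    _ = _ := by
      rw [ENNReal.mul_rpow_of_nonneg _ _ hpq.nonneg, ← ENNReal.rpow_mul, ← ENNReal.rpow_mul,
        one_div_mul_cancel hpq.pos.ne', ENNReal.rpow_one, mul_comm, one_div_mul_eq_div]

lemma lintegral_lintegral_mul_rpow_le {α β : Type*} [MeasurableSpace α] [MeasurableSpace β]
    (μ : Measure α) (ν : Measure β) [SFinite μ] [SFinite ν] {B F : α → β → ENNReal}
    (hB : Measurable (Function.uncurry B)) (hF : Measurable (Function.uncurry F)) {b : ENNReal}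
    (hb : ∀ t, ∫⁻ x, B x t ^ (2 : ℝ) ∂μ ≤ b ^ (2 : ℝ)) :
    (∫⁻ x, (∫⁻ t, B x t * F x t ∂ν) ^ (4 / 3 : ℝ) ∂μ) ^ (3 / 2 : ℝ) ≤
      ν univ * b ^ (2 : ℝ) * ∫⁻ t, (∫⁻ x, F x t ^ (4 : ℝ) ∂μ) ^ (1 / 2 : ℝ) ∂ν := by
  have hBx : ∀ x, Measurable (B x) := fun x => hB.comp measurable_prodMk_left
  have hFx : ∀ x, Measurable (F x) := fun x => hF.comp measurable_prodMk_left
  have hBt : ∀ t, Measurable fun x => B x t := fun t => hB.comp measurable_prodMk_right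
  have hFt : ∀ t, Measurable fun x => F x t := fun t => hF.comp measurable_prodMk_right
  have hΦ : Measurable fun t => ∫⁻ x, F x t ^ (4 : ℝ) ∂μ :=
    Measurable.lintegral_prod_left' (hF.pow_const _)
  have c1 : Real.HolderConjugate (4 / 3) 4 := by
    rw [Real.holderConjugate_iff]; norm_num
  have c2 : Real.HolderConjugate (3 / 2) 3 := by
    rw [Real.holderConjugate_iff]; norm_num
  have hold : ∀ t, ∫⁻ x, (B x t * F x t) ^ (4 / 3 : ℝ) ∂μ ≤
      b ^ (4 / 3 : ℝ) * (∫⁻ x, F x t ^ (4 : ℝ) ∂μ) ^ (1 / 3 : ℝ) := by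
    intro t
    have h := ENNReal.lintegral_mul_le_Lp_mul_Lq μ c2 ((hBt t).pow_const (4 / 3 : ℝ)).aemeasurable
      ((hFt t).pow_const (4 / 3 : ℝ)).aemeasurable
    simp only [Pi.mul_apply, ← ENNReal.rpow_mul] at h
    norm_num at h
    calc ∫⁻ x, (B x t * F x t) ^ (4 / 3 : ℝ) ∂μ
        = ∫⁻ x, B x t ^ (4 / 3 : ℝ) * F x t ^ (4 / 3 : ℝ) ∂μ := by
          simp only [ENNReal.mul_rpow_of_nonneg _ _ (by norm_num : (0 : ℝ) ≤ 4 / 3)]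
      _ ≤ (∫⁻ x, B x t ^ (2 : ℝ) ∂μ) ^ (2 / 3 : ℝ) * (∫⁻ x, F x t ^ (4 : ℝ) ∂μ) ^ (1 / 3 : ℝ) := by
          simpa using h
      _ ≤ (b ^ (2 : ℝ)) ^ (2 / 3 : ℝ) * (∫⁻ x, F x t ^ (4 : ℝ) ∂μ) ^ (1 / 3 : ℝ) := by
          gcongr; exact hb t
      _ = _ := by rw [← ENNReal.rpow_mul]; norm_num
  have step1 : ∫⁻ x, (∫⁻ t, B x t * F x t ∂ν) ^ (4 / 3 : ℝ) ∂μ ≤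
      ν univ ^ (1 / 3 : ℝ) * (b ^ (4 / 3 : ℝ) *
        ∫⁻ t, (∫⁻ x, F x t ^ (4 : ℝ) ∂μ) ^ (1 / 3 : ℝ) ∂ν) := by
    calc ∫⁻ x, (∫⁻ t, B x t * F x t ∂ν) ^ (4 / 3 : ℝ) ∂μ
        ≤ ∫⁻ x, ν univ ^ (1 / 3 : ℝ) * ∫⁻ t, (B x t * F x t) ^ (4 / 3 : ℝ) ∂ν ∂μ := by
          refine lintegral_mono fun x => ?_
          have := lintegral_rpow_le_measure_univ_rpow_mul ν c1 ((hBx x).mul (hFx x)).aemeasurable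
          norm_num at this
          simpa using this
      _ = ν univ ^ (1 / 3 : ℝ) * ∫⁻ t, ∫⁻ x, (B x t * F x t) ^ (4 / 3 : ℝ) ∂μ ∂ν := by
          have hm : Measurable (Function.uncurry fun x t => (B x t * F x t) ^ (4 / 3 : ℝ)) :=
            (hB.mul hF).pow_const _
          rw [lintegral_const_mul _ hm.lintegral_prod_right, lintegral_lintegral_swap hm.aemeasurable]
      _ ≤ _ := by
          rw [← lintegral_const_mul _ (hΦ.pow_const _)]
          gcongr with t
          exact hold t
  have step2 := lintegral_rpow_le_measure_univ_rpow_mul ν c2 (hΦ.pow_const (1 / 3 : ℝ)).aemeasurable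
  simp only [← ENNReal.rpow_mul] at step2
  norm_num at step2
  calc _ ≤ (ν univ ^ (1 / 3 : ℝ) * (b ^ (4 / 3 : ℝ) *
        ∫⁻ t, (∫⁻ x, F x t ^ (4 : ℝ) ∂μ) ^ (1 / 3 : ℝ) ∂ν)) ^ (3 / 2 : ℝ) := by gcongr
    _ = ν univ ^ (1 / 2 : ℝ) * (b ^ (2 : ℝ) *
        (∫⁻ t, (∫⁻ x, F x t ^ (4 : ℝ) ∂μ) ^ (1 / 3 : ℝ) ∂ν) ^ (3 / 2 : ℝ)) := by
        rw [ENNReal.mul_rpow_of_nonneg _ _ (by norm_num), ENNReal.mul_rpow_of_nonneg _ _ (by norm_num),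
          ← ENNReal.rpow_mul, ← ENNReal.rpow_mul]
        norm_num
    _ ≤ ν univ ^ (1 / 2 : ℝ) * (b ^ (2 : ℝ) *
        (ν univ ^ (1 / 2 : ℝ) * ∫⁻ t, (∫⁻ x, F x t ^ (4 : ℝ) ∂μ) ^ (1 / 2 : ℝ) ∂ν)) := by
        gcongr
        simpa using step2
    _ = (ν univ ^ (1 / 2 : ℝ) * ν univ ^ (1 / 2 : ℝ)) * b ^ (2 : ℝ) *
        ∫⁻ t, (∫⁻ x, F x t ^ (4 : ℝ) ∂μ) ^ (1 / 2 : ℝ) ∂ν := by ring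
    _ = _ := by
        rw [← ENNReal.rpow_add_of_nonneg _ _ (by norm_num) (by norm_num)]
        norm_num

/-- The difference quotient in `x₂` is bounded in `L²_h` by the `L^∞_v(L²_h)` norm of the
vertical derivative. -/
lemma lintegral_sub_rpow_two_le {a b : ℝ × ℝ → ℂ} (hb : Continuous b)
    (hd : ∀ x y, HasDerivAt (fun s => a (x, s)) (b (x, y)) y) {β : ENNReal}
    (hβ : ∀ y, ∫⁻ x in I2pi, ‖b (x, y)‖ₑ ^ (2 : ℝ) ≤ β ^ (2 : ℝ)) (y t : ℝ) :
    ∫⁻ x in I2pi, ‖a (x, y - t) - a (x, y)‖ₑ ^ (2 : ℝ) ≤ (‖t‖ₑ * β) ^ (2 : ℝ) := by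
  have hm : Measurable fun p : ℝ × ℝ => ‖b p‖ₑ ^ (2 : ℝ) := hb.enorm.measurable.pow_const _
  have hvol : volume (uIoc y (y - t)) = ‖t‖ₑ := by
    rw [Real.volume_uIoc, ← Real.norm_eq_abs, ofReal_norm, sub_sub_cancel_left, enorm_neg]
  have h1 : ∀ x, ‖a (x, y - t) - a (x, y)‖ₑ ^ (2 : ℝ) ≤
      ‖t‖ₑ * ∫⁻ s in uIoc y (y - t), ‖b (x, s)‖ₑ ^ (2 : ℝ) := by
    intro x
    have hbx : Continuous fun s => b (x, s) := by fun_prop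
    have e := intervalIntegral.integral_eq_sub_of_hasDerivAt (fun s _ => hd x s)
      (hbx.intervalIntegrable y (y - t))
    have h2 : ‖a (x, y - t) - a (x, y)‖ₑ ≤ ∫⁻ s in uIoc y (y - t), ‖b (x, s)‖ₑ := by
      rw [← e, ← ofReal_norm, intervalIntegral.norm_intervalIntegral_eq, ofReal_norm]
      exact enorm_integral_le_lintegral_enorm _
    have c : Real.HolderConjugate 2 2 := by rw [Real.holderConjugate_iff]; norm_num
    have h3 := lintegral_rpow_le_measure_univ_rpow_mul (volume.restrict (uIoc y (y - t))) c
      hbx.enorm.measurable.aemeasurable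
    rw [Measure.restrict_apply_univ, hvol, div_self two_ne_zero, ENNReal.rpow_one] at h3
    exact (ENNReal.rpow_le_rpow h2 (by norm_num)).trans h3
  calc _ ≤ ∫⁻ x in I2pi, ‖t‖ₑ * ∫⁻ s in uIoc y (y - t), ‖b (x, s)‖ₑ ^ (2 : ℝ) :=
        lintegral_mono h1
    _ = ‖t‖ₑ * ∫⁻ s in uIoc y (y - t), ∫⁻ x in I2pi, ‖b (x, s)‖ₑ ^ (2 : ℝ) := by
        rw [lintegral_const_mul _ hm.lintegral_prod_right',
          lintegral_lintegral_swap hm.aemeasurable]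
    _ ≤ ‖t‖ₑ * ∫⁻ s in uIoc y (y - t), β ^ (2 : ℝ) := by gcongr; exact hβ _
    _ = _ := by
        rw [setLIntegral_const, hvol, ENNReal.mul_rpow_of_nonneg _ _ zero_le_two,
          ENNReal.rpow_two, ENNReal.rpow_two]
        ring

lemma le_essSup_restrict_I2pi {G : ℝ → ℝ} (hG : Continuous G) (hp : Function.Periodic G (2 * π))
    (y : ℝ) : G y ≤ essSup G (volume.restrict I2pi) := by
  by_contra! hlt
  obtain ⟨y', hy', e⟩ := hp.exists_mem_Ioc Real.two_pi_pos y 0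
  rw [e] at hlt
  have hbdd : IsBoundedUnder (· ≤ ·) (ae (volume.restrict I2pi)) G := by
    obtain ⟨M, hM⟩ := (isCompact_Icc (a := (0 : ℝ)) (b := 2 * π)).exists_bound_of_continuousOn
      hG.continuousOn
    refine ⟨M, eventually_map.2 ?_⟩
    filter_upwards [ae_restrict_mem measurableSet_Ioc] with x hx
    exact (le_abs_self _).trans (hM x (Ioc_subset_Icc_self hx))
  have hae := ae_le_essSup hbdd
  have hopen : IsOpen {x | essSup G (volume.restrict I2pi) < G x} := isOpen_lt continuous_const hG
  have hcl : y' ∈ closure (Ioo 0 (2 * π)) := by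
    rw [closure_Ioo Real.two_pi_pos.ne]
    rw [zero_add] at hy'
    exact Ioc_subset_Icc_self hy'
  have hne := mem_closure_iff.1 hcl _ hopen hlt
  have hpos := (hopen.inter isOpen_Ioo).measure_pos volume hne
  rw [I2pi, ae_restrict_iff' measurableSet_Ioc, ← I2pi] at hae
  refine hpos.ne' (measure_mono_null (fun x hx => ?_) (ae_iff.1 hae))
  simp only [mem_ofPred_eq, Classical.not_imp, not_le]
  exact ⟨Ioo_subset_Ioc_self hx.2, hx.1⟩

lemma lintegral_rpow_two_le_LinfvL2h {b : ℝ × ℝ → ℂ} (hb : Continuous b)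
    (hp : ∀ x y, b (x, y + 2 * π) = b (x, y)) :
    0 ≤ LinfvL2h b ∧
      ∀ y, ∫⁻ x in I2pi, ‖b (x, y)‖ₑ ^ (2 : ℝ) ≤ ENNReal.ofReal (LinfvL2h b) ^ (2 : ℝ) := by
  have hc : Continuous fun y => Real.sqrt (∫ x in I2pi, ‖b (x, y)‖ ^ 2) := by
    simp only [integral_I2pi]
    refine Real.continuous_sqrt.comp
      (intervalIntegral.continuous_parametric_intervalIntegral_of_continuous' ?_ _ _)
    fun_prop
  have hle : ∀ y, Real.sqrt (∫ x in I2pi, ‖b (x, y)‖ ^ 2) ≤ LinfvL2h b :=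
    le_essSup_restrict_I2pi hc fun y => by simp only [hp]
  refine ⟨(Real.sqrt_nonneg _).trans (hle 0), fun y => ?_⟩
  have hcy : Continuous fun x => ‖b (x, y)‖ ^ 2 := by fun_prop
  have e : ∫⁻ x in I2pi, ‖b (x, y)‖ₑ ^ (2 : ℝ) = ENNReal.ofReal (∫ x in I2pi, ‖b (x, y)‖ ^ 2) := by
    rw [ofReal_integral_eq_lintegral_ofReal (integrableOn_I2pi_of_continuous hcy)
      (ae_of_all _ fun x => by positivity)]
    refine lintegral_congr fun x => ?_
    rw [ENNReal.rpow_two, ENNReal.ofReal_pow (norm_nonneg _), ofReal_norm]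
  rw [e, ENNReal.rpow_two, ← ENNReal.ofReal_pow ((Real.sqrt_nonneg _).trans (hle 0))]
  refine ENNReal.ofReal_le_ofReal ?_
  exact (Real.sqrt_le_left ((Real.sqrt_nonneg _).trans (hle 0))).1 (hle y)

lemma exists_kernel_bound_blockSymb {χ θ : ℝ → ℝ} (hp : IsDyadicPartition χ θ) :
    ∃ K > 0, ∀ k : ℤ, -1 ≤ k → ∃ S : Finset ℤ, (∀ n : ℤ, n ∉ S → blockSymb χ θ k n = 0) ∧
      ∫⁻ t in Ioc (-π) π, ‖t‖ₑ * ‖trigKer (blockSymb χ θ k) S t‖ₑ ≤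
        ENNReal.ofReal (K * (2 : ℝ) ^ (-k)) := by
  obtain ⟨R1, hR1, h1⟩ := hp.chi_support
  obtain ⟨r, R2, hr, hrR, h2⟩ := hp.theta_support
  have h1' : ∀ z, R1 < |z| → χ z = 0 := fun z hz => h1 z hz.le
  have h2' : ∀ z, R2 < |z| → θ z = 0 := fun z hz => h2 z (Or.inr hz)
  obtain ⟨K1, hK1, b1⟩ := exists_lintegral_kernel_bound hR1 hp.smooth_chi h1'
  obtain ⟨K2, hK2, b2⟩ := exists_lintegral_kernel_bound (hr.trans hrR) hp.smooth_theta h2'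
  have abs_chi : ∀ z, χ |z| = χ z := fun z => by
    rcases abs_choice z with h | h <;> rw [h]
    exact hp.even_chi z
  have abs_theta : ∀ c z, θ (c * |z|) = θ (c * z) := fun c z => by
    rcases abs_choice z with h | h <;> rw [h]
    rw [mul_neg, hp.even_theta]
  refine ⟨max K1 K2, lt_max_of_lt_left hK1, fun k hk => ?_⟩
  obtain ⟨ψ, N, K, R, hN, hKle, hψ, hb, hm⟩ : ∃ (ψ : ℝ → ℝ) (N K R : ℝ), 1 ≤ N ∧
      K / N ≤ max K1 K2 * (2 : ℝ) ^ (-k) ∧ (∀ z, R < |z| → ψ z = 0) ∧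
      (∀ N : ℝ, 1 ≤ N → ∀ (m : ℝ → ℝ) (S : Finset ℤ),
        (∀ n : ℤ, m n = ψ (n / N)) → (∀ n : ℤ, n ∉ S → m n = 0) →
        ∫⁻ t in Ioc (-π) π, ‖t‖ₑ * ‖trigKer m S t‖ₑ ≤ ENNReal.ofReal (K / N)) ∧
      ∀ n : ℤ, blockSymb χ θ k n = ψ (n / N) := by
    rcases hk.eq_or_lt with rfl | hk
    · refine ⟨χ, 1, K1, R1, le_rfl, ?_, h1', b1, fun n => ?_⟩
      · norm_num
        have := le_max_left K1 K2
        linarith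
      · simp [blockSymb, abs_chi]
    · have hk0 : 0 ≤ k := by omega
      refine ⟨θ, (2 : ℝ) ^ k, K2, R2, one_le_zpow₀ one_le_two hk0, ?_, h2', b2, fun n => ?_⟩
      · rw [zpow_neg, div_eq_mul_inv]
        gcongr
        exact le_max_right _ _
      · rw [blockSymb, if_neg (by omega), if_pos hk0, abs_theta, zpow_neg, inv_mul_eq_div]
  have hfin := support_dilate_finite (lt_of_lt_of_le one_pos hN) hψ
  have hS : ∀ n : ℤ, n ∉ hfin.toFinset → blockSymb χ θ k n = 0 := fun n hn => by
    rw [hm]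
    simpa using hn
  exact ⟨hfin.toFinset, hS, (hb N hN _ _ hm hS).trans (ENNReal.ofReal_le_ofReal hKle)⟩

lemma exists_finset_lowSymb {χ θ : ℝ → ℝ} (hp : IsDyadicPartition χ θ) (j : ℤ) :
    ∃ S : Finset ℤ, ∀ n : ℤ, n ∉ S → lowSymb χ θ j n = 0 := by
  obtain ⟨K, -, hK⟩ := exists_kernel_bound_blockSymb hp
  choose! S hS using fun k hk => (hK k hk)
  refine ⟨(Finset.Icc (-1) (j - 2)).biUnion S, fun n hn => Finset.sum_eq_zero fun i hi => ?_⟩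
  refine (hS i (Finset.mem_Icc.1 hi).1).1 n fun h => hn ?_
  exact Finset.mem_biUnion.2 ⟨i, hi, h⟩

lemma L2vL43h_le_of_lintegral_le {c : ℝ × ℝ → ℂ} {M : ℝ} (hM : 0 ≤ M)
    (h : ∫⁻ y in I2pi, (∫⁻ x in I2pi, ‖c (x, y)‖ₑ ^ (4 / 3 : ℝ)) ^ (3 / 2 : ℝ) ≤
      ENNReal.ofReal (M ^ 2)) : L2vL43h c ≤ M := by
  refine Real.sqrt_le_iff.2 ⟨hM, ?_⟩
  rw [← ENNReal.ofReal_le_ofReal_iff (sq_nonneg M)]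
  refine le_trans ?_ h
  refine (Real.ofReal_le_enorm _).trans ((enorm_integral_le_lintegral_enorm _).trans ?_)
  refine lintegral_mono fun y => ?_
  rw [Real.enorm_rpow_of_nonneg (integral_nonneg fun x => by positivity) (by norm_num)]
  refine ENNReal.rpow_le_rpow ((enorm_integral_le_lintegral_enorm _).trans_eq ?_) (by norm_num)
  refine lintegral_congr fun x => ?_
  rw [Real.enorm_rpow_of_nonneg (norm_nonneg _) (by norm_num), enorm_norm]

lemma exists_commutator_bound : ∃ C > 0, ∀ (h : ℝ → ℂ) (w : ℝ) (a b f c : ℝ × ℝ → ℂ),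
    Continuous h → 0 ≤ w →
    ∫⁻ t in Ioc (-π) π, ‖t‖ₑ * ‖h t‖ₑ ≤ ENNReal.ofReal w →
    Continuous a → Continuous b → (∀ x y, HasDerivAt (fun s => a (x, s)) (b (x, y)) y) →
    (∀ x y, b (x, y + 2 * π) = b (x, y)) → HReg f →
    (∀ x, c x = ∫ t in (-π)..π, h t * ((a (x.1, x.2 - t) - a x) * f (x.1, x.2 - t))) →
    L2vL43h c ≤ C * w * LinfvL2h b * L2vHsh (1 / 4) f := by
  obtain ⟨C, hC, hsob⟩ := lintegral_pow_four_le
  refine ⟨Real.sqrt (Real.sqrt C), by positivity, ?_⟩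
  intro h w a b f c hh hw0 hw ha hb hd hbp hf hc
  obtain ⟨hβ0, hβ⟩ := lintegral_rpow_two_le_LinfvL2h hb hbp
  obtain ⟨hsum, hH⟩ := hf.summable_H1Sq
  set β := LinfvL2h b
  set H : ℝ → ℝ := fun y => H1Sq (1 / 4) fun x => f (x, y) with hHdef
  have hH0 : ∀ y, 0 ≤ H y := fun y => tsum_nonneg fun n => by positivity
  have hHp : Function.Periodic H (2 * π) := fun y => by simp only [hHdef, hf.per2]
  have hfc := hf.cont
  have hρ : Measurable fun t : ℝ => ‖t‖ₑ * ‖h t‖ₑ :=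
    measurable_enorm.mul hh.enorm.measurable
  set ν : Measure ℝ := (volume.restrict (Ioc (-π) π)).withDensity fun t => ‖t‖ₑ * ‖h t‖ₑ with hν
  have hW : ν univ ≤ ENNReal.ofReal w := by
    rw [hν, withDensity_apply _ MeasurableSet.univ, Measure.restrict_univ]
    exact hw
  have : SFinite ν := by
    have : IsFiniteMeasure ν := ⟨hW.trans_lt ENNReal.ofReal_lt_top⟩
    infer_instance
  have hpt : ∀ x y, ‖c (x, y)‖ₑ ≤
      ∫⁻ t, (‖a (x, y - t) - a (x, y)‖ₑ * ‖t‖ₑ⁻¹) * ‖f (x, y - t)‖ₑ ∂ν := by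
    intro x y
    have hm : Measurable fun t => (‖a (x, y - t) - a (x, y)‖ₑ * ‖t‖ₑ⁻¹) * ‖f (x, y - t)‖ₑ := by
      have c1 : Continuous fun t => a (x, y - t) - a (x, y) := by fun_prop
      have c2 : Continuous fun t => f (x, y - t) := by fun_prop
      exact (c1.enorm.measurable.mul measurable_enorm.inv).mul c2.enorm.measurable
    rw [hν, lintegral_withDensity_eq_lintegral_mul _ hρ hm, hc,
      intervalIntegral.integral_of_le (by linarith [Real.pi_pos])]
    refine (enorm_integral_le_lintegral_enorm _).trans (lintegral_mono fun t => ?_)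
    simp only [Pi.mul_apply, enorm_mul]
    rcases eq_or_ne t 0 with rfl | ht
    · simp
    · have h0 : ‖t‖ₑ ≠ 0 := by simpa using ht
      have e : ‖t‖ₑ * ‖t‖ₑ⁻¹ = 1 := ENNReal.mul_inv_cancel h0 enorm_ne_top
      refine le_of_eq ?_
      calc _ = (‖t‖ₑ * ‖t‖ₑ⁻¹) * (‖h t‖ₑ * (‖a (x, y - t) - a (x, y)‖ₑ * ‖f (x, y - t)‖ₑ)) := by
            rw [e, one_mul]
        _ = _ := by ring
  have hB : ∀ y t, ∫⁻ x in I2pi, (‖a (x, y - t) - a (x, y)‖ₑ * ‖t‖ₑ⁻¹) ^ (2 : ℝ) ≤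
      ENNReal.ofReal β ^ (2 : ℝ) := by
    intro y t
    have c1 : Continuous fun x => a (x, y - t) - a (x, y) := by fun_prop
    calc _ = (∫⁻ x in I2pi, ‖a (x, y - t) - a (x, y)‖ₑ ^ (2 : ℝ)) * ‖t‖ₑ⁻¹ ^ (2 : ℝ) := by
          simp only [ENNReal.mul_rpow_of_nonneg _ _ zero_le_two]
          rw [lintegral_mul_const _ (c1.enorm.measurable.pow_const _)]
      _ ≤ (‖t‖ₑ * ENNReal.ofReal β) ^ (2 : ℝ) * ‖t‖ₑ⁻¹ ^ (2 : ℝ) := by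
          gcongr
          exact lintegral_sub_rpow_two_le hb hd hβ y t
      _ = (‖t‖ₑ * ‖t‖ₑ⁻¹ * ENNReal.ofReal β) ^ (2 : ℝ) := by
          rw [← ENNReal.mul_rpow_of_nonneg _ _ zero_le_two]
          ring_nf
      _ ≤ (1 * ENNReal.ofReal β) ^ (2 : ℝ) := by
          gcongr
          exact ENNReal.mul_inv_le_one _
      _ = _ := by rw [one_mul]
  have hΦ : ∀ z, (∫⁻ x in I2pi, ‖f (x, z)‖ₑ ^ (4 : ℝ)) ^ (1 / 2 : ℝ) ≤
      ENNReal.ofReal (Real.sqrt C * H z) := by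
    intro z
    have h4 := hsob (fun x => f (x, z)) (hf.continuous_slice z) (hsum z)
    have e4 : ∀ r : ENNReal, r ^ (4 : ℝ) = r ^ 4 := fun r => by
      rw [← ENNReal.rpow_natCast]; norm_num
    simp only [e4]
    calc _ ≤ ENNReal.ofReal (C * H z ^ 2) ^ (1 / 2 : ℝ) := by gcongr
      _ = _ := by
        rw [ENNReal.ofReal_rpow_of_nonneg (by positivity) (by norm_num), ← Real.sqrt_eq_rpow,
          Real.sqrt_mul hC.le, Real.sqrt_sq (hH0 z)]
  have hy : ∀ y, (∫⁻ x in I2pi, ‖c (x, y)‖ₑ ^ (4 / 3 : ℝ)) ^ (3 / 2 : ℝ) ≤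
      ENNReal.ofReal w * ENNReal.ofReal β ^ (2 : ℝ) *
        ∫⁻ t, ENNReal.ofReal (Real.sqrt C * H (y - t)) ∂ν := by
    intro y
    have mB : Measurable (Function.uncurry fun x t : ℝ => ‖a (x, y - t) - a (x, y)‖ₑ * ‖t‖ₑ⁻¹) := by
      have c1 : Continuous fun p : ℝ × ℝ => a (p.1, y - p.2) - a (p.1, y) := by fun_prop
      exact c1.enorm.measurable.mul (measurable_enorm.comp measurable_snd).inv
    have mF : Measurable (Function.uncurry fun x t : ℝ => ‖f (x, y - t)‖ₑ) := by
      have c1 : Continuous fun p : ℝ × ℝ => f (p.1, y - p.2) := by fun_prop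
      exact c1.enorm.measurable
    refine le_trans ?_ ((lintegral_lintegral_mul_rpow_le (volume.restrict I2pi) ν mB mF
      (hB y)).trans ?_)
    · gcongr with x
      exact hpt x y
    · gcongr with t
      exact hΦ (y - t)
  have hshift : ∀ t, ∫⁻ y in I2pi, ENNReal.ofReal (Real.sqrt C * H (y - t)) =
      ENNReal.ofReal (Real.sqrt C * ∫ y in I2pi, H y) := by
    intro t
    have ct : Continuous fun y => Real.sqrt C * H (y - t) := by fun_prop
    rw [← ofReal_integral_eq_lintegral_ofReal (integrableOn_I2pi_of_continuous ct)
      (ae_of_all _ fun y => mul_nonneg (Real.sqrt_nonneg _) (hH0 _)), integral_const_mul]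
    congr 2
    rw [integral_I2pi, integral_I2pi, intervalIntegral.integral_comp_sub_right]
    have := hHp.intervalIntegral_add_eq (0 - t) 0
    rwa [zero_add, show 0 - t + 2 * π = 2 * π - t by ring] at this
  have hHint : 0 ≤ ∫ y in I2pi, H y := integral_nonneg hH0
  refine L2vL43h_le_of_lintegral_le (by unfold L2vHsh; positivity) ?_
  have mH : Measurable (Function.uncurry fun y t : ℝ => ENNReal.ofReal (Real.sqrt C * H (y - t))) := by
    have c1 : Continuous fun p : ℝ × ℝ => Real.sqrt C * H (p.1 - p.2) := by fun_prop
    exact c1.measurable.ennreal_ofReal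
  calc _ ≤ ∫⁻ y in I2pi, ENNReal.ofReal w * ENNReal.ofReal β ^ (2 : ℝ) *
        ∫⁻ t, ENNReal.ofReal (Real.sqrt C * H (y - t)) ∂ν := lintegral_mono hy
    _ = ENNReal.ofReal w * ENNReal.ofReal β ^ (2 : ℝ) *
        ∫⁻ t, (∫⁻ y in I2pi, ENNReal.ofReal (Real.sqrt C * H (y - t))) ∂ν := by
        rw [lintegral_const_mul _ mH.lintegral_prod_right, lintegral_lintegral_swap mH.aemeasurable]
    _ ≤ ENNReal.ofReal w * ENNReal.ofReal β ^ (2 : ℝ) *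
        (ENNReal.ofReal (Real.sqrt C * ∫ y in I2pi, H y) * ENNReal.ofReal w) := by
        simp only [hshift, lintegral_const]
        gcongr
    _ = ENNReal.ofReal (w * β ^ 2 * ((Real.sqrt C * ∫ y in I2pi, H y) * w)) := by
        rw [ENNReal.rpow_two, ← ENNReal.ofReal_pow hβ0, ← ENNReal.ofReal_mul hw0,
          ← ENNReal.ofReal_mul (by positivity), ← ENNReal.ofReal_mul (by positivity)]
    _ = _ := by
        congr 1
        rw [L2vHsh, mul_pow, mul_pow, mul_pow, Real.sq_sqrt (Real.sqrt_nonneg _),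
          Real.sq_sqrt hHint]
        ring

lemma commutator_eq_integral {K : ℝ → ℂ} (hK : Continuous K) (hKp : Function.Periodic K (2 * π))
    {a f : ℝ × ℝ → ℂ} (ha : HReg a) (hf : HReg f) (x : ℝ × ℝ) :
    vconv K (fun y => a y * f y) x - a x * vconv K f x =
      ∫ t in (-π)..π, K t * ((a (x.1, x.2 - t) - a x) * f (x.1, x.2 - t)) := by
  have ca := ha.cont
  have cf := hf.cont
  rw [vconv_eq_shift hKp (ha.mul hf).per2, vconv_eq_shift hKp hf.per2,
    ← intervalIntegral.integral_const_mul, ← intervalIntegral.integral_sub]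
  · congr 1
    funext t
    ring
  · exact Continuous.intervalIntegrable (by fun_prop) _ _
  · exact Continuous.intervalIntegrable (by fun_prop) _ _

/-- commutator estimate
`‖[Δ^v_k, S^v_{k'−1}u²] f‖_{L²_v(L^{4/3}_h)} ≤ C 2^{-k} ‖S^v_{k'−1}∂₁u¹‖_{L^∞_v(L²_h)} ‖f‖_{L²_v(H^{1/4}_h)}`. -/
theorem commutator_mixed_estimate (χ θ : ℝ → ℝ) (hp : IsDyadicPartition χ θ) (N₀ : ℤ) :
    ∃ C > 0, ∀ u : ℝ × ℝ → ℝ × ℝ, SmoothV u → PerV u → DivFree u →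
      ∀ f : ℝ × ℝ → ℝ, Smooth f → Per f →
      ∀ k k' : ℤ, -1 ≤ k → -1 ≤ k' → |k - k'| ≤ N₀ →
      L2vL43h (fun x =>
          LPC χ θ k (fun y => Sv χ θ (k' - 1) (comp2 u) y * (f y : ℂ)) x -
            Sv χ θ (k' - 1) (comp2 u) x * LP χ θ k f x) ≤
        C * (2 : ℝ) ^ (-k) * LinfvL2h (Sv χ θ (k' - 1) (pd1 (comp1 u))) *
          L2vHsh (1/4) (fun x => (f x : ℂ)) := by
  obtain ⟨K, hK, hblock⟩ := exists_kernel_bound_blockSymb hp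
  obtain ⟨C, hC, hcomm⟩ := exists_commutator_bound
  refine ⟨C * K, by positivity, fun u hu hup hdiv f hf hfp k k' hk _ _ => ?_⟩
  obtain ⟨S, hS, hker⟩ := hblock k hk
  obtain ⟨T, hT⟩ := exists_finset_lowSymb hp (k' - 1)
  set h := trigKer (blockSymb χ θ k) S
  set l := trigKer (lowSymb χ θ (k' - 1)) T
  have ch : Continuous h := (contDiff_trigKer _ _).continuous
  have ph : Function.Periodic h (2 * π) := trigKer_periodic _ _
  have cl : Continuous l := (contDiff_trigKer _ _).continuous
  have pl : Function.Periodic l (2 * π) := trigKer_periodic _ _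
  have s1 : Smooth (comp1 u) := contDiff_fst.comp hu
  have s2 : Smooth (comp2 u) := contDiff_snd.comp hu
  have r1 := HReg.of_smooth s1.pd1 (Per.pd1 s1 hup.1)
  have r2 := HReg.of_smooth s2 hup.2
  have rf := HReg.of_smooth hf hfp
  have eb : Sv χ θ (k' - 1) (pd1 (comp1 u)) = vconv l fun x => (pd1 (comp1 u) x : ℂ) :=
    funext fun x => r1.tsum_multiplier hT x
  have ea : Sv χ θ (k' - 1) (comp2 u) = vconv l fun x => (comp2 u x : ℂ) :=
    funext fun x => r2.tsum_multiplier hT x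
  rw [ea, eb]
  set a := vconv l fun x => (comp2 u x : ℂ)
  set b := vconv l fun x => (pd1 (comp1 u) x : ℂ)
  have ra : HReg a := r2.vconv cl pl
  have rb : HReg b := r1.vconv cl pl
  have hd : ∀ x y, HasDerivAt (fun s => a (x, s)) (-b (x, y)) y := by
    intro x y
    have e : -b (x, y) = vconv l (fun x => -(pd1 (comp1 u) x : ℂ)) (x, y) := by
      simp only [b, vconv, mul_neg, integral_neg]
    rw [e]
    refine hasDerivAt_vconv_snd cl pl r2.cont r1.cont.neg r2.per2
      (fun x y => congrArg Neg.neg (r1.per2 x y)) (fun x y => ?_) x y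
    have h1 := (hasDerivAt_slice_snd s2 x y).ofReal_comp
    rwa [show pd2 (comp2 u) (x, y) = -pd1 (comp1 u) (x, y) by linarith [hdiv (x, y)],
      Complex.ofReal_neg] at h1
  have hb : LinfvL2h (fun x => -b x) = LinfvL2h b := by simp only [LinfvL2h, norm_neg]
  have key := hcomm h (K * (2 : ℝ) ^ (-k)) a (fun x => -b x) (fun x => (f x : ℂ))
    (fun x => LPC χ θ k (fun y => a y * (f y : ℂ)) x - a x * LP χ θ k f x) ch (by positivity) hker
    ra.cont rb.cont.neg hd (fun x y => by rw [rb.per2]) rf fun x => by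
      rw [← commutator_eq_integral ch ph ra rf]
      congr 1
      · exact (ra.mul rf).tsum_multiplier hS x
      · congr 1
        exact rf.tsum_multiplier hS x
  rw [hb] at key
  rwa [mul_assoc C K]

end Aniso
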